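/- arXiv:1204.5519 — 2 statements merged into one kernel-verified Lean document; each statement's English description precedes it below -/
import Mathlib

section
/- Fix finite nonempty sets Θ, Ω, A with n = |Θ| and m = |Ω|, a utility function u : Θ × Ω × A → ℝ, and a product probability distribution μ on Ω × Θ (μ(ω,θ) = μ(ω)·μ(θ)) with μ(ω) > 0 for all ω. Then the supremum R_c(u,μ) over valid Pricing Mappings menus is attained, and moreover it is attained by a valid Pricing Mappings menu satisfying |supp(x_θ)| ≤ m + n − 1 for every θ ∈ Θ and ∑_{θ∈Θ} |supp(x_θ)| ≤ mn + n(n−1)/2. -/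
open Finset Filter

noncomputable section

variable {Θ Ω A : Type*}

/-- `p` is a probability distribution on the finite set `Ω`. -/
def IsDist [Fintype Ω] (p : Ω → ℝ) : Prop :=
  (∀ ω, 0 ≤ p ω) ∧ ∑ ω, p ω = 1

/-- `μ` is a joint probability distribution on `Ω × Θ`. -/
def IsJoint [Fintype Ω] [Fintype Θ] (μ : Ω → Θ → ℝ) : Prop :=
  (∀ ω θ, 0 ≤ μ ω θ) ∧ ∑ ω, ∑ θ, μ ω θ = 1

/-- The marginal `μ(ω) = ∑_θ μ(ω,θ)` of a joint distribution. -/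
def margO [Fintype Θ] (μ : Ω → Θ → ℝ) (ω : Ω) : ℝ := ∑ θ, μ ω θ

/-- The marginal `μ(θ) = ∑_ω μ(ω,θ)` of a joint distribution. -/
def margT [Fintype Ω] (μ : Ω → Θ → ℝ) (θ : Θ) : ℝ := ∑ ω, μ ω θ

/-- The value function `v_θ(q) = max_{a ∈ A} ∑_ω q(ω)·u(θ,ω,a)`. -/
def vfun [Fintype Ω] [Fintype A] [Nonempty A] (u : Θ → Ω → A → ℝ) (θ : Θ) (q : Ω → ℝ) : ℝ :=
  univ.sup' univ_nonempty fun a => ∑ ω, q ω * u θ ω a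

/-- The matrix-vector product `D_θ q`, where `D_θ` is the diagonal matrix with entries
`μ(θ|ω) = μ(ω,θ)/μ(ω)`. -/
def Dq [Fintype Θ] (μ : Ω → Θ → ℝ) (θ : Θ) (q : Ω → ℝ) : Ω → ℝ :=
  fun ω => μ ω θ / margO μ ω * q ω

/-- `1ᵀ D_θ q`. -/
def onesD [Fintype Θ] [Fintype Ω] (μ : Ω → Θ → ℝ) (θ : Θ) (q : Ω → ℝ) : ℝ :=
  ∑ ω, Dq μ θ q ω

/-- A feasible signal-representation for prior `pr`: a finitely supported distribution over
posteriors (each posterior being a distribution on `Ω`) averaging to the prior. -/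
def FeasRep [Fintype Ω] (pr : Ω → ℝ) (x : (Ω → ℝ) →₀ ℝ) : Prop :=
  (∀ q ∈ x.support, IsDist q) ∧ (∀ q, 0 ≤ x q) ∧
  (∑ q ∈ x.support, x q = 1) ∧ ∀ ω, ∑ q ∈ x.support, x q * q ω = pr ω

variable [Fintype Θ] [Fintype Ω] [Fintype A] [Nonempty A]

/-- Expected value `∑_q v_θ(D_θ q)·x(q)` that a type-`θ` buyer gets from
signal representation `x`. -/
def PMutil (u : Θ → Ω → A → ℝ) (μ : Ω → Θ → ℝ) (θ : Θ) (x : (Ω → ℝ) →₀ ℝ) : ℝ :=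
  ∑ q ∈ x.support, vfun u θ (Dq μ θ q) * x q

/-- Validity (IR and IC) of a Pricing Mappings menu `{(x_θ, t_θ)}`. -/
def PMvalid (u : Θ → Ω → A → ℝ) (μ : Ω → Θ → ℝ)
    (x : Θ → ((Ω → ℝ) →₀ ℝ)) (t : Θ → ℝ) : Prop :=
  (∀ θ, FeasRep (margO μ) (x θ)) ∧ (∀ θ, 0 ≤ t θ) ∧
  (∀ θ, vfun u θ (Dq μ θ (margO μ)) ≤ PMutil u μ θ (x θ) - margT μ θ * t θ) ∧
  (∀ θ θ', θ' ≠ θ →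
    PMutil u μ θ (x θ') - margT μ θ * t θ' ≤ PMutil u μ θ (x θ) - margT μ θ * t θ)

/-- Revenue `∑_θ μ(θ)·t_θ` of a Pricing Mappings menu. -/
def PMrev (μ : Ω → Θ → ℝ) (t : Θ → ℝ) : ℝ := ∑ θ, margT μ θ * t θ

/-- `R_c(u,μ)`: the supremum of revenues of valid Pricing Mappings menus. -/
def Rc (u : Θ → Ω → A → ℝ) (μ : Ω → Θ → ℝ) : ℝ :=
  sSup {r | ∃ x t, PMvalid u μ x t ∧ r = PMrev μ t}

/-- Net utility `∑_q [v_θ(D_θ q)·x(q) − (1ᵀD_θ q)·t̃(q)]` of a type-`θ` buyer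
from a Pricing Outcomes contract `(x, tt)`. -/
def POutil (u : Θ → Ω → A → ℝ) (μ : Ω → Θ → ℝ) (θ : Θ)
    (x tt : (Ω → ℝ) →₀ ℝ) : ℝ :=
  ∑ q ∈ x.support ∪ tt.support,
    (vfun u θ (Dq μ θ q) * x q - onesD μ θ q * tt q)

/-- Validity (feasibility, payments supported on signals, IR and IC) of a Pricing Outcomes
menu `{(x_θ, t̃_θ)}`. -/
def POvalid (u : Θ → Ω → A → ℝ) (μ : Ω → Θ → ℝ)
    (x tt : Θ → ((Ω → ℝ) →₀ ℝ)) : Prop :=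
  (∀ θ, FeasRep (margO μ) (x θ)) ∧ (∀ θ, (tt θ).support ⊆ (x θ).support) ∧
  (∀ θ, vfun u θ (Dq μ θ (margO μ)) ≤ POutil u μ θ (x θ) (tt θ)) ∧
  (∀ θ θ', θ' ≠ θ →
    POutil u μ θ (x θ') (tt θ') ≤ POutil u μ θ (x θ) (tt θ))

/-- Revenue `∑_θ ∑_q (1ᵀD_θ q)·t̃_θ(q)` of a Pricing Outcomes menu. -/
def POrev (μ : Ω → Θ → ℝ) (tt : Θ → ((Ω → ℝ) →₀ ℝ)) : ℝ :=
  ∑ θ, ∑ q ∈ (tt θ).support, onesD μ θ q * tt θ q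

/-- `R(u,μ)`: the supremum of revenues of valid Pricing Outcomes menus. -/
def Rfull (u : Θ → Ω → A → ℝ) (μ : Ω → Θ → ℝ) : ℝ :=
  sSup {r | ∃ x tt, POvalid u μ x tt ∧ r = POrev μ tt}

/-- `R_p(u,μ)`: the supremum of revenues of valid Pricing Outcomes menus with no positive
transfers to the buyer, i.e. all payments nonnegative. -/
def Rp (u : Θ → Ω → A → ℝ) (μ : Ω → Θ → ℝ) : ℝ :=
  sSup {r | ∃ x tt, POvalid u μ x tt ∧ (∀ θ q, 0 ≤ tt θ q) ∧ r = POrev μ tt}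

/-- `max_a u(θ,ω,a)`. -/
def maxU (u : Θ → Ω → A → ℝ) (θ : Θ) (ω : Ω) : ℝ :=
  univ.sup' univ_nonempty fun a => u θ ω a

/-- The buyer surplus
`σ(θ) = ∑_ω μ(ω|θ)·max_a u(θ,ω,a) − max_a ∑_ω μ(ω|θ)·u(θ,ω,a)`. -/
def surplus (u : Θ → Ω → A → ℝ) (μ : Ω → Θ → ℝ) (θ : Θ) : ℝ :=
  ∑ ω, μ ω θ / margT μ θ * maxU u θ ω -
    univ.sup' univ_nonempty fun a => ∑ ω, μ ω θ / margT μ θ * u θ ω a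

/-- The full surplus `∑_θ μ(θ)·σ(θ)`. -/
def fullSurplus (u : Θ → Ω → A → ℝ) (μ : Ω → Θ → ℝ) : ℝ :=
  ∑ θ, margT μ θ * surplus u μ θ

/-- The sealed-envelope revenue `R_e(u,μ) = sup_{t ≥ 0} t·∑_{θ : μ(θ)>0, σ(θ) ≥ t} μ(θ)`. -/
def Re (u : Θ → Ω → A → ℝ) (μ : Ω → Θ → ℝ) : ℝ :=
  sSup {r | ∃ t : ℝ, 0 ≤ t ∧
    r = t * ∑ θ, (if 0 < margT μ θ ∧ t ≤ surplus u μ θ then margT μ θ else 0)}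

/-- The cell of the simplex on which, for each type `θ`, action `α θ` is optimal:
on this polytope every `v_θ` is linear. -/
def cellPM (u : Θ → Ω → A → ℝ) (α : Θ → A) : Set (Ω → ℝ) :=
  {q | IsDist q ∧ ∀ θ a, ∑ ω, q ω * u θ ω a ≤ ∑ ω, q ω * u θ ω (α θ)}

/-- `Q*(u)`: the set of vertices (extreme points) of the cells of the partition of the simplex
into polytopes on which every `v_θ` is linear. -/
def Qstar (u : Θ → Ω → A → ℝ) : Set (Ω → ℝ) :=
  ⋃ α : Θ → A, Set.extremePoints ℝ (cellPM u α)

/-- The cell of the simplex on which, for each type `θ`, action `α θ` is optimal for the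
transformed posterior `D_θ q`: on this polytope every `q ↦ v_θ(D_θ q)` is linear. -/
def cellPO (u : Θ → Ω → A → ℝ) (μ : Ω → Θ → ℝ) (α : Θ → A) : Set (Ω → ℝ) :=
  {q | IsDist q ∧ ∀ θ a, ∑ ω, Dq μ θ q ω * u θ ω a ≤ ∑ ω, Dq μ θ q ω * u θ ω (α θ)}

/-- `Q*(u,μ)`: the set of vertices (extreme points) of the cells of the partition of the simplex
into polytopes on which every `q ↦ v_θ(D_θ q)` is linear. -/
def QstarD (u : Θ → Ω → A → ℝ) (μ : Ω → Θ → ℝ) : Set (Ω → ℝ) :=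
  ⋃ α : Θ → A, Set.extremePoints ℝ (cellPO u μ α)

/-- The point mass at `ω`, as an element of `Δ(Ω)`. -/
def deltaP [DecidableEq Ω] (ω : Ω) : Ω → ℝ := fun ω' => if ω' = ω then 1 else 0

/-- The full-revelation signal representation: posterior `δ_ω` with probability `μ(ω)`. -/
def fullX [DecidableEq Ω] (μ : Ω → Θ → ℝ) : (Ω → ℝ) →₀ ℝ :=
  ∑ ω, Finsupp.single (deltaP ω) (margO μ ω)

/-- The full-revelation payment function: `t̃(δ_ω) = μ(ω)·t(ω)`. -/
def fullT [DecidableEq Ω] (μ : Ω → Θ → ℝ) (t : Ω → ℝ) : (Ω → ℝ) →₀ ℝ :=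
  ∑ ω, Finsupp.single (deltaP ω) (margO μ ω * t ω)


/-- A nonnegative combination of vectors lying in an affine hyperplane off the origin can be
supported on at most as many points as the dimension, without decreasing a given linear
objective. -/
theorem exists_sparse_combination {E κ : Type*} [Fintype κ] (a : E → κ → ℝ) (b : E → ℝ)
    (L : (κ → ℝ) →ₗ[ℝ] ℝ) (x : E →₀ ℝ) (hx : ∀ q, 0 ≤ x q) (hL : ∀ q ∈ x.support, L (a q) = 1) :
    ∃ y : E →₀ ℝ, (∀ q, 0 ≤ y q) ∧ y.support ⊆ x.support ∧
      Finsupp.linearCombination ℝ a y = Finsupp.linearCombination ℝ a x ∧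
      Finsupp.linearCombination ℝ b x ≤ Finsupp.linearCombination ℝ b y ∧
      y.support.card ≤ Fintype.card κ := by
  classical
  induction hn : x.support.card using Nat.strong_induction_on generalizing x with
  | _ n ih =>
  by_cases hcard : x.support.card ≤ Fintype.card κ
  · exact ⟨x, hx, subset_rfl, rfl, le_rfl, hcard⟩
  have hdep : ¬ LinearIndepOn ℝ a (x.support : Set E) := by
    intro h
    have := LinearIndependent.fintype_card_le_finrank h
    simp only [Module.finrank_fintype_fun_eq_card] at this
    exact hcard (by simpa using this)
  obtain ⟨d, hds, hd0, hdne, hdb⟩ : ∃ d : E →₀ ℝ, d.support ⊆ x.support ∧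
      Finsupp.linearCombination ℝ a d = 0 ∧ d ≠ 0 ∧ 0 ≤ Finsupp.linearCombination ℝ b d := by
    rw [linearIndepOn_iff] at hdep
    push Not at hdep
    obtain ⟨d, hd, hd0, hdne⟩ := hdep
    have hds : d.support ⊆ x.support := by
      simpa [Finsupp.mem_supported] using hd
    rcases le_total 0 (Finsupp.linearCombination ℝ b d) with h | h
    · exact ⟨d, hds, hd0, hdne, h⟩
    · exact ⟨-d, by simpa using hds, by simp [hd0], by simpa using hdne, by simpa using h⟩
  have hsum : ∑ q ∈ d.support, d q = 0 := by
    have h : L (Finsupp.linearCombination ℝ a d) = 0 := by rw [hd0, map_zero]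
    rw [Finsupp.apply_linearCombination, Finsupp.linearCombination_apply, Finsupp.sum] at h
    rw [← h]
    exact Finset.sum_congr rfl fun q hq => by simp [hL q (hds hq)]
  have hneg : (d.support.filter fun q => d q < 0).Nonempty := by
    by_contra hne
    rw [Finset.not_nonempty_iff_eq_empty, Finset.filter_eq_empty_iff] at hne
    push Not at hne
    have h := (Finset.sum_eq_zero_iff_of_nonneg fun q hq => hne hq).1 hsum
    exact hdne (Finsupp.ext fun q => by
      by_cases hq : q ∈ d.support
      · exact h q hq
      · simpa using hq)
  obtain ⟨q₀, hq₀, hmin⟩ := Finset.exists_min_image _ (fun q => x q / -d q) hneg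
  have hd₀ : d q₀ < 0 := (Finset.mem_filter.1 hq₀).2
  set s := x q₀ / -d q₀ with hs
  have hs0 : 0 ≤ s := div_nonneg (hx q₀) (by linarith)
  have hy : ∀ q, 0 ≤ (x + s • d) q := by
    intro q
    simp only [Finsupp.add_apply, Finsupp.smul_apply, smul_eq_mul]
    rcases le_or_gt 0 (d q) with h | h
    · exact add_nonneg (hx q) (mul_nonneg hs0 h)
    · have := hmin q (Finset.mem_filter.2 ⟨Finsupp.mem_support_iff.2 h.ne, h⟩)
      rw [le_div_iff₀ (by linarith)] at this
      linarith
  have hsub : (x + s • d).support ⊆ x.support := by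
    refine Finsupp.support_add.trans (Finset.union_subset subset_rfl ?_)
    exact Finsupp.support_smul.trans hds
  have hlt : (x + s • d).support ⊂ x.support := by
    refine (Finset.ssubset_iff_of_subset hsub).2 ⟨q₀, hds (Finset.mem_filter.1 hq₀).1, ?_⟩
    simp only [Finsupp.mem_support_iff, Finsupp.add_apply, Finsupp.smul_apply, smul_eq_mul,
      not_not, hs]
    field_simp [hd₀.ne]
    ring
  obtain ⟨y, hy0, hyx, hya, hyb, hyc⟩ := ih _ (hn ▸ Finset.card_lt_card hlt) _ hy
    (fun q hq => hL q (hsub hq)) rfl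
  refine ⟨y, hy0, hyx.trans hsub, ?_, le_trans ?_ hyb, hyc⟩
  · rw [hya]; simp [hd0]
  · simpa using mul_nonneg hs0 hdb

/-- The value `∑_q v_θ(q)·x(q)` of a signal representation for type `θ`, linear in `x`. -/
def signalValue (u : Θ → Ω → A → ℝ) (θ : Θ) (x : (Ω → ℝ) →₀ ℝ) : ℝ :=
  Finsupp.linearCombination ℝ (vfun u θ) x

/-- Vectors of values, one for each type, of the signal representations of the prior `p`. -/
def attainable (u : Θ → Ω → A → ℝ) (p : Ω → ℝ) : Set (Θ → ℝ) :=
  {w | ∃ x, FeasRep p x ∧ ∀ θ, w θ = signalValue u θ x}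

theorem linearCombination_apply_coord {E κ : Type*} (f : E → κ → ℝ) (x : E →₀ ℝ) (k : κ) :
    Finsupp.linearCombination ℝ f x k = Finsupp.linearCombination ℝ (fun q => f q k) x := by
  simp [Finsupp.linearCombination_apply, Finsupp.sum]

theorem feasRep_iff {Ω : Type*} [Fintype Ω] {p : Ω → ℝ} (hp : ∑ ω, p ω = 1)
    (x : (Ω → ℝ) →₀ ℝ) :
    FeasRep p x ↔ (∀ q ∈ x.support, IsDist q) ∧ (∀ q, 0 ≤ x q) ∧
      ∀ ω, Finsupp.linearCombination ℝ (fun q : Ω → ℝ => q ω) x = p ω := by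
  simp only [FeasRep, Finsupp.linearCombination_apply, Finsupp.sum, smul_eq_mul]
  refine ⟨fun h => ⟨h.1, h.2.1, h.2.2.2⟩, fun h => ⟨h.1, h.2.1, ?_, h.2.2⟩⟩
  rw [← hp, ← Finset.sum_congr rfl fun ω _ => h.2.2 ω, Finset.sum_comm]
  refine Finset.sum_congr rfl fun q hq => ?_
  rw [← Finset.mul_sum, (h.1 q hq).2, mul_one]

/-- A signal representation can be sparsified so that it keeps its value for the types in `P` and
does not decrease a given linear objective. -/
theorem exists_sparse_feasRep
    {Θ Ω A : Type*} [Fintype Ω] [Fintype A] [Nonempty A]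
    (u : Θ → Ω → A → ℝ) {p : Ω → ℝ} (hp : ∑ ω, p ω = 1)
    {x : (Ω → ℝ) →₀ ℝ} (hx : FeasRep p x) (P : Finset Θ) (b : (Ω → ℝ) → ℝ) :
    ∃ y, FeasRep p y ∧ (∀ θ ∈ P, signalValue u θ y = signalValue u θ x) ∧
      Finsupp.linearCombination ℝ b x ≤ Finsupp.linearCombination ℝ b y ∧
      y.support.card ≤ Fintype.card Ω + P.card := by
  rw [feasRep_iff hp] at hx
  let a : (Ω → ℝ) → (Ω ⊕ P) → ℝ := fun q => Sum.elim q fun θ => vfun u θ.1 q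
  let L : ((Ω ⊕ P) → ℝ) →ₗ[ℝ] ℝ := ∑ ω, LinearMap.proj (Sum.inl ω)
  obtain ⟨y, hy0, hys, hya, hyb, hyc⟩ := exists_sparse_combination a b L x hx.2.1 fun q hq => by
    simpa [L, a] using (hx.1 q hq).2
  have hk : ∀ k, Finsupp.linearCombination ℝ (fun q => a q k) y =
      Finsupp.linearCombination ℝ (fun q => a q k) x := fun k => by
    rw [← linearCombination_apply_coord, hya, linearCombination_apply_coord]
  refine ⟨y, (feasRep_iff hp y).2 ⟨fun q hq => hx.1 q (hys hq), hy0, fun ω => ?_⟩,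
    fun θ hθ => hk (Sum.inr ⟨θ, hθ⟩), hyb, by simpa using hyc⟩
  rw [← hx.2.2 ω]
  exact hk (Sum.inl ω)

theorem vfun_mem_attainable
    {Θ Ω A : Type*} [Fintype Ω] [Fintype A] [Nonempty A]
    (u : Θ → Ω → A → ℝ) {p : Ω → ℝ} (hp : IsDist p) :
    (fun θ => vfun u θ p) ∈ attainable u p := by
  classical
  refine ⟨Finsupp.single p 1, (feasRep_iff hp.2 _).2 ⟨fun q hq => ?_, fun q => ?_, fun ω => ?_⟩,
    fun θ => ?_⟩
  · rw [Finset.mem_singleton.1 (Finsupp.support_single_subset hq)]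
    exact hp
  · rw [Finsupp.single_apply]; split_ifs <;> norm_num
  · simp
  · simp [signalValue]

theorem continuous_vfun
    {Θ Ω A : Type*} [Fintype Ω] [Fintype A] [Nonempty A]
    (u : Θ → Ω → A → ℝ) (θ : Θ) : Continuous (vfun u θ) :=
  Continuous.finset_sup'_apply univ_nonempty fun a _ => by fun_prop

theorem isCompact_attainable (u : Θ → Ω → A → ℝ) {p : Ω → ℝ} (hp : IsDist p) :
    IsCompact (attainable u p) := by
  classical
  let C (k : ℕ) : Set ((Fin k → ℝ) × (Fin k → Ω → ℝ)) :=
    (stdSimplex ℝ (Fin k) ×ˢ Set.univ.pi fun _ => stdSimplex ℝ Ω) ∩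
      {cz | ∀ ω, ∑ i, cz.1 i * cz.2 i ω = p ω}
  let F (k : ℕ) (cz : (Fin k → ℝ) × (Fin k → Ω → ℝ)) : Θ → ℝ :=
    fun θ => ∑ i, cz.1 i * vfun u θ (cz.2 i)
  have hcomp (k : ℕ) : IsCompact (F k '' C k) := by
    refine IsCompact.image ?_ ?_
    · refine IsCompact.inter_right
        ((isCompact_stdSimplex ℝ _).prod (isCompact_univ_pi fun _ => isCompact_stdSimplex ℝ _)) ?_
      simp only [Set.ofPred_forall]
      exact isClosed_iInter fun ω => isClosed_eq (by fun_prop) continuous_const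
    · refine continuous_pi fun θ => continuous_finsetSum _ fun i _ => ?_
      have := continuous_vfun u θ
      fun_prop
  suffices attainable u p =
      ⋃ k ∈ Finset.range (Fintype.card Ω + Fintype.card Θ + 1), F k '' C k by
    rw [this]
    exact (Finset.range _).isCompact_biUnion fun k _ => hcomp k
  refine Set.Subset.antisymm ?_ ?_
  · rintro w ⟨x, hx, hw⟩
    obtain ⟨y, hy, hyv, -, hyc⟩ := exists_sparse_feasRep u hp.2 hx univ 0
    simp only [Set.mem_iUnion]
    refine ⟨y.support.card, Finset.mem_range.2 (Nat.lt_succ_of_le hyc), ?_⟩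
    let e := y.support.equivFin.symm
    have hsum (f : (Ω → ℝ) → ℝ) : ∑ i, f (e i) = ∑ q ∈ y.support, f q := by
      rw [e.sum_comp fun q : y.support => f q, Finset.sum_coe_sort]
    refine ⟨(fun i => y (e i), fun i => e i), ⟨⟨⟨fun i => hy.2.1 _, ?_⟩, ?_⟩, ?_⟩, ?_⟩
    · rw [← hy.2.2.1]; exact hsum y
    · exact fun i _ => hy.1 _ (e i).2
    · exact fun ω => (hsum fun q => y q * q ω).trans (hy.2.2.2 ω)
    · funext θ
      rw [hw θ, ← hyv θ (mem_univ θ), signalValue, Finsupp.linearCombination_apply, Finsupp.sum]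
      exact hsum fun q => y q * vfun u θ q
  · simp only [Set.iUnion_subset_iff]
    rintro k - _ ⟨⟨c, z⟩, ⟨⟨hc, hz⟩, hcz⟩, rfl⟩
    refine ⟨∑ i, Finsupp.single (z i) (c i),
      (feasRep_iff hp.2 _).2 ⟨fun q hq => ?_, fun q => ?_, fun ω => ?_⟩, fun θ => ?_⟩
    · obtain ⟨i, -, hi⟩ := Finset.mem_biUnion.1 (Finsupp.support_finsetSum hq)
      rw [Finset.mem_singleton.1 (Finsupp.support_single_subset hi)]
      exact hz i (Set.mem_univ i)
    · rw [Finsupp.finsetSum_apply]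
      refine Finset.sum_nonneg fun i _ => ?_
      rw [Finsupp.single_apply]
      split_ifs
      exacts [hc.1 i, le_rfl]
    · simpa using hcz ω
    · simp [F, signalValue]

/-- A menu in the space of values: type `θ` is offered the value vector `W θ` at price `t θ`, and
the offers are individually rational with reservation values `r` and incentive compatible. -/
def IsValueMenu {Θ : Type*} (S : Set (Θ → ℝ)) (r : Θ → ℝ) (W : Θ → Θ → ℝ) (t : Θ → ℝ) : Prop :=
  (∀ θ, W θ ∈ S) ∧ (∀ θ, 0 ≤ t θ) ∧ (∀ θ, r θ ≤ W θ θ - t θ) ∧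
    ∀ θ θ', W θ' θ - t θ' ≤ W θ θ - t θ

theorem isCompact_setOf_isValueMenu {Θ : Type*} [Finite Θ] {S : Set (Θ → ℝ)} (hS : IsCompact S)
    (r : Θ → ℝ) : IsCompact {m : (Θ → Θ → ℝ) × (Θ → ℝ) | IsValueMenu S r m.1 m.2} := by
  have hbdd (θ : Θ) : ∃ B, ∀ w ∈ S, w θ ≤ B := by
    obtain ⟨B, hB⟩ := (hS.image (continuous_apply θ)).bddAbove
    exact ⟨B, fun w hw => hB ⟨w, hw, rfl⟩⟩
  choose B hB using hbdd
  have hK : IsCompact ((Set.univ.pi fun _ : Θ => S) ×ˢ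
      (Set.univ.pi fun θ => Set.Icc 0 (B θ - r θ))) :=
    (isCompact_univ_pi fun _ => hS).prod (isCompact_univ_pi fun _ => isCompact_Icc)
  refine hK.of_isClosed_subset ?_ ?_
  · simp only [IsValueMenu, Set.ofPred_and, Set.ofPred_forall]
    refine IsClosed.inter (isClosed_iInter fun θ => hS.isClosed.preimage (by fun_prop)) ?_
    refine IsClosed.inter (isClosed_iInter fun θ => isClosed_le (by fun_prop) (by fun_prop)) ?_
    refine IsClosed.inter (isClosed_iInter fun θ => isClosed_le (by fun_prop) (by fun_prop)) ?_
    exact isClosed_iInter fun θ => isClosed_iInter fun θ' =>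
      isClosed_le (by fun_prop) (by fun_prop)
  · rintro ⟨W, t⟩ ⟨hW, ht, hr, -⟩
    refine ⟨fun θ _ => hW θ, fun θ _ => ⟨ht θ, ?_⟩⟩
    have h₁ := hr θ
    have h₂ := hB θ _ (hW θ)
    simp only at h₁ h₂ ⊢
    linarith

/-- There is a revenue-maximal menu such that an additional offer `y` at the price of type `θ`
which does not attract types paying strictly more than `t θ` attracts no type at all. It is
obtained by maximizing first the revenue and then the total utility. -/
theorem exists_optimal_isValueMenu {Θ : Type*} [Fintype Θ] {S : Set (Θ → ℝ)} (hS : IsCompact S)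
    {r : Θ → ℝ} (hr : r ∈ S) {g : Θ → ℝ} (hg : ∀ θ, 0 ≤ g θ) :
    ∃ W t, IsValueMenu S r W t ∧
      (∀ W' t', IsValueMenu S r W' t' → ∑ θ, g θ * t' θ ≤ ∑ θ, g θ * t θ) ∧
      ∀ θ, ∀ y ∈ S, (∀ θ', t θ < t θ' → y θ' - t θ ≤ W θ' θ' - t θ') →
        ∀ θ', y θ' - t θ ≤ W θ' θ' - t θ' := by
  classical
  let rev (m : (Θ → Θ → ℝ) × (Θ → ℝ)) : ℝ := ∑ θ, g θ * m.2 θ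
  let util (m : (Θ → Θ → ℝ) × (Θ → ℝ)) : ℝ := ∑ θ, (m.1 θ θ - m.2 θ)
  have hrev : Continuous rev := by fun_prop
  have hutil : Continuous util := by fun_prop
  have hK := isCompact_setOf_isValueMenu hS r
  obtain ⟨m₀, hm₀, hmax₀⟩ := hK.exists_isMaxOn
    ⟨(fun _ => r, 0), fun _ => hr, fun _ => le_rfl, fun _ => by simp, fun _ _ => by simp⟩
    hrev.continuousOn
  obtain ⟨⟨W, t⟩, ⟨hm, hmr⟩, hmax⟩ :=
    (hK.inter_right (isClosed_singleton.preimage hrev : IsClosed (rev ⁻¹' {rev m₀}))).exists_isMaxOn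
      ⟨m₀, hm₀, rfl⟩ hutil.continuousOn
  have hmr : rev (W, t) = rev m₀ := hmr
  have hopt : ∀ W' t', IsValueMenu S r W' t' → rev (W', t') ≤ rev (W, t) := fun W' t' h => by
    rw [hmr]
    exact hmax₀ (show (W', t') ∈ _ from h)
  refine ⟨W, t, hm, hopt, fun θ y hy hhigh => ?_⟩
  by_contra! ⟨θ₀, hθ₀⟩
  obtain ⟨hW, ht, hIR, hIC⟩ := hm
  let sw (θ' : Θ) : Prop := W θ' θ' - t θ' < y θ' - t θ
  let W' (θ' : Θ) : Θ → ℝ := if sw θ' then y else W θ'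
  let t' (θ' : Θ) : ℝ := if sw θ' then t θ else t θ'
  have hge (θ' : Θ) : W θ' θ' - t θ' ≤ W' θ' θ' - t' θ' := by
    by_cases h : sw θ'
    · simpa [W', t', h] using h.le
    · simp [W', t', h]
  have hgey (θ' : Θ) : y θ' - t θ ≤ W' θ' θ' - t' θ' := by
    by_cases h : sw θ'
    · simp [W', t', h]
    · simpa [W', t', h] using not_lt.1 h
  have hmenu : IsValueMenu S r W' t' := by
    refine ⟨fun θ' => ?_, fun θ' => ?_, fun θ' => (hIR θ').trans (hge θ'), fun θ₁ θ₂ => ?_⟩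
    · by_cases h : sw θ' <;> simp [W', h, hy, hW]
    · by_cases h : sw θ' <;> simp [t', h, ht]
    · by_cases h : sw θ₂
      · simpa [W', t', h] using hgey θ₁
      · simpa [W', t', h] using (hIC θ₁ θ₂).trans (hge θ₁)
  have htt (θ' : Θ) : t θ' ≤ t' θ' := by
    by_cases h : sw θ'
    · simp only [t', h, if_true]
      by_contra! hlt
      exact (hhigh θ' hlt).not_gt h
    · simp [t', h]
  have hrev_eq : rev (W', t') = rev m₀ :=
    le_antisymm (hmax₀ (show (W', t') ∈ _ from hmenu)) (hmr ▸
      Finset.sum_le_sum fun θ' _ => mul_le_mul_of_nonneg_left (htt θ') (hg θ'))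
  have hle : util (W', t') ≤ util (W, t) :=
    hmax (show (W', t') ∈ _ from ⟨hmenu, hrev_eq⟩)
  refine hle.not_gt (Finset.sum_lt_sum (fun θ' _ => hge θ') ⟨θ₀, mem_univ _, ?_⟩)
  exact hθ₀.trans_le (hgey θ₀)

theorem PMutil_eq_margT_mul_signalValue (u : Θ → Ω → A → ℝ) {μ : Ω → Θ → ℝ}
    (hμ : ∀ ω θ, 0 ≤ μ ω θ) (hprod : ∀ ω θ, μ ω θ = margO μ ω * margT μ θ)
    (hO : ∀ ω, 0 < margO μ ω) (θ : Θ) :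
    (∀ q, vfun u θ (Dq μ θ q) = margT μ θ * vfun u θ q) ∧
      ∀ x, PMutil u μ θ x = margT μ θ * signalValue u θ x := by
  have hg : 0 ≤ margT μ θ := Finset.sum_nonneg fun ω _ => hμ ω θ
  have hv (q : Ω → ℝ) : vfun u θ (Dq μ θ q) = margT μ θ * vfun u θ q := by
    rw [vfun, vfun, Finset.mul₀_sup' hg]
    refine Finset.sup'_congr _ rfl fun a _ => ?_
    rw [Finset.mul_sum]
    refine Finset.sum_congr rfl fun ω _ => ?_
    rw [Dq, hprod, mul_div_cancel_left₀ _ (hO ω).ne']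
    ring
  refine ⟨hv, fun x => ?_⟩
  rw [PMutil, signalValue, Finsupp.linearCombination_apply, Finsupp.sum, Finset.mul_sum]
  refine Finset.sum_congr rfl fun q _ => ?_
  rw [hv, smul_eq_mul]
  ring

/-- Letting types of weight zero choose their preferred offer, incentive constraints for the types
of positive weight suffice to obtain a menu with the same revenue. -/
theorem exists_isValueMenu_of_pos {Θ : Type*} [Fintype Θ] {S : Set (Θ → ℝ)} {r : Θ → ℝ}
    (hr : r ∈ S) {g : Θ → ℝ} (hg : ∀ θ, 0 ≤ g θ) {W : Θ → Θ → ℝ} {t : Θ → ℝ}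
    (hW : ∀ θ, W θ ∈ S) (ht : ∀ θ, 0 ≤ t θ) (hIR : ∀ θ, 0 < g θ → r θ ≤ W θ θ - t θ)
    (hIC : ∀ θ θ', 0 < g θ → W θ' θ - t θ' ≤ W θ θ - t θ) :
    ∃ W' t', IsValueMenu S r W' t' ∧ ∑ θ, g θ * t' θ = ∑ θ, g θ * t θ := by
  let o (j : Option {θ // 0 < g θ}) : (Θ → ℝ) × ℝ := j.elim (r, 0) fun θ => (W θ, t θ)
  have hoS : ∀ j, (o j).1 ∈ S
    | none => hr
    | some θ => hW θ
  have ho0 : ∀ j, 0 ≤ (o j).2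
    | none => le_rfl
    | some θ => ht θ
  have hbest (θ : Θ) : ∃ j, (∀ j', (o j').1 θ - (o j').2 ≤ (o j).1 θ - (o j).2) ∧
      ∀ h : 0 < g θ, j = some ⟨θ, h⟩ := by
    by_cases h : 0 < g θ
    · refine ⟨some ⟨θ, h⟩, ?_, fun _ => rfl⟩
      rintro (_ | θ')
      · simpa [o] using hIR θ h
      · exact hIC θ θ' h
    · obtain ⟨j, hj⟩ := Finite.exists_max fun j => (o j).1 θ - (o j).2
      exact ⟨j, hj, fun h' => absurd h' h⟩
  choose c hc hcpos using hbest
  refine ⟨fun θ => (o (c θ)).1, fun θ => (o (c θ)).2, ⟨fun θ => hoS _, fun θ => ho0 _,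
    fun θ => ?_, fun θ θ' => hc θ (c θ')⟩, Finset.sum_congr rfl fun θ _ => ?_⟩
  · simpa [o] using hc θ none
  · rcases (hg θ).eq_or_lt with h | h
    · simp [← h]
    · simp [hcpos θ h, o]

theorem sum_card_filter_lt_le {Θ : Type*} [Fintype Θ] (t : Θ → ℝ) :
    ∑ θ, (univ.filter fun θ' => t θ < t θ').card ≤ Fintype.card Θ * (Fintype.card Θ - 1) / 2 := by
  classical
  have hswap : ∑ θ, (univ.filter fun θ' => t θ < t θ').card =
      ∑ θ, (univ.filter fun θ' => t θ' < t θ).card := by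
    simp only [Finset.card_filter]
    exact Finset.sum_comm
  have hpair (θ : Θ) : (univ.filter fun θ' => t θ < t θ').card +
      (univ.filter fun θ' => t θ' < t θ).card ≤ Fintype.card Θ - 1 := by
    rw [← Finset.card_union_of_disjoint (Finset.disjoint_filter.2 fun _ _ h => h.not_gt),
      ← Finset.card_univ, ← Finset.card_erase_of_mem (mem_univ θ)]
    refine Finset.card_le_card fun θ' h => Finset.mem_erase.2 ⟨?_, mem_univ _⟩
    rintro rfl
    simp at h
  have hsum := Finset.sum_le_sum fun θ (_ : θ ∈ univ) => hpair θ
  rw [Finset.sum_add_distrib, ← hswap, Finset.sum_const, Finset.card_univ, smul_eq_mul] at hsum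
  rw [Nat.le_div_iff_mul_le two_pos]
  linarith

/-- For a product distribution with positive `Ω`-marginal, the supremum
`R_c(u,μ)` is attained, and attained by a valid Pricing Mappings menu whose signal supports
satisfy `|supp(x_θ)| ≤ m + n − 1` for every `θ` and `∑_θ |supp(x_θ)| ≤ mn + n(n−1)/2`. -/
theorem optimal_menu_small_support [Nonempty Θ] [Nonempty Ω]
    (u : Θ → Ω → A → ℝ) (μ : Ω → Θ → ℝ) (hμ : IsJoint μ)
    (hprod : ∀ ω θ, μ ω θ = margO μ ω * margT μ θ)
    (hO : ∀ ω, 0 < margO μ ω) :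
    ∃ x t, PMvalid u μ x t ∧ PMrev μ t = Rc u μ ∧
      (∀ θ, (x θ).support.card ≤ Fintype.card Ω + Fintype.card Θ - 1) ∧
      ∑ θ, (x θ).support.card ≤
        Fintype.card Ω * Fintype.card Θ + Fintype.card Θ * (Fintype.card Θ - 1) / 2 := by
  have hp : IsDist (margO μ) := ⟨fun ω => (hO ω).le, hμ.2⟩
  have hg (θ : Θ) : 0 ≤ margT μ θ := Finset.sum_nonneg fun ω _ => hμ.1 ω θ
  have hPM := PMutil_eq_margT_mul_signalValue u hμ.1 hprod hO
  have hr := vfun_mem_attainable u hp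
  obtain ⟨W, t, ⟨hW, ht, hIR, hIC⟩, hopt, hoffer⟩ :=
    exists_optimal_isValueMenu (isCompact_attainable u hp) hr hg
  choose X hX hWX using hW
  choose x hx hxP hxθ hxc using fun θ =>
    exists_sparse_feasRep u hp.2 (hX θ) (univ.filter fun θ' => t θ < t θ') (vfun u θ)
  have henvy (θ θ' : Θ) : signalValue u θ' (x θ) - t θ ≤ W θ' θ' - t θ' := by
    refine hoffer θ (fun θ' => signalValue u θ' (x θ)) ⟨x θ, hx θ, fun _ => rfl⟩ (fun θ₁ h => ?_) θ'
    rw [hxP θ θ₁ (by simpa using h), ← hWX θ θ₁]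
    exact hIC θ₁ θ
  have hown (θ : Θ) : W θ θ ≤ signalValue u θ (x θ) := (hWX θ θ).le.trans (hxθ θ)
  have hvalid : PMvalid u μ x t := by
    refine ⟨hx, ht, fun θ => ?_, fun θ θ' _ => ?_⟩
    · rw [(hPM θ).1, (hPM θ).2, ← mul_sub]
      exact mul_le_mul_of_nonneg_left (by linarith [hIR θ, hown θ]) (hg θ)
    · rw [(hPM θ).2, (hPM θ).2, ← mul_sub, ← mul_sub]
      exact mul_le_mul_of_nonneg_left (by linarith [henvy θ' θ, hown θ]) (hg θ)
  have hmax : IsGreatest {r | ∃ x t, PMvalid u μ x t ∧ r = PMrev μ t} (PMrev μ t) := by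
    refine ⟨⟨x, t, hvalid, rfl⟩, ?_⟩
    rintro _ ⟨x', t', ⟨hx', ht', hIR', hIC'⟩, rfl⟩
    obtain ⟨W'', t'', hmenu, hrev⟩ := exists_isValueMenu_of_pos hr hg
      (W := fun θ θ' => signalValue u θ' (x' θ)) (t := t')
      (fun θ => ⟨x' θ, hx' θ, fun _ => rfl⟩) ht'
      (fun θ h => by
        have := hIR' θ
        rw [(hPM θ).1, (hPM θ).2, ← mul_sub] at this
        exact le_of_mul_le_mul_left this h)
      (fun θ θ' h => by
        rcases eq_or_ne θ' θ with rfl | hne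
        · exact le_rfl
        have := hIC' θ θ' hne
        rw [(hPM θ).2, (hPM θ).2, ← mul_sub, ← mul_sub] at this
        exact le_of_mul_le_mul_left this h)
    rw [PMrev, ← hrev]
    exact hopt W'' t'' hmenu
  refine ⟨x, t, hvalid, hmax.csSup_eq.symm, fun θ => ?_, ?_⟩
  · have hlt : (univ.filter fun θ' => t θ < t θ').card < Fintype.card Θ :=
      Finset.card_lt_univ_of_notMem (x := θ) (by simp)
    have := hxc θ
    omega
  · calc ∑ θ, (x θ).support.card
        ≤ ∑ θ, (Fintype.card Ω + (univ.filter fun θ' => t θ < t θ').card) :=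
          Finset.sum_le_sum fun θ _ => hxc θ
      _ ≤ _ := by
          rw [Finset.sum_add_distrib, Finset.sum_const, Finset.card_univ, smul_eq_mul,
            mul_comm (Fintype.card Θ)]
          exact Nat.add_le_add_left (sum_card_filter_lt_le t) _
end
end

section
/- For every integer n ≥ 1 there exist a context with Θ = {1,…,n}, |Ω| = 2, a finite action set A, and a product probability distribution μ on Ω × Θ (μ(ω,θ) = μ(ω)·μ(θ)) with μ(ω) > 0 for each ω and μ(θ) > 0 for each θ, such that the supremum R_c(u,μ) over valid Pricing Mappings menus is attained, and every valid Pricing Mappings menu whose revenue equals R_c(u,μ) satisfies |supp(x_θ)| ≥ θ + 1 for every θ ∈ {1,…,n}, and hence ∑_{θ=1}^{n} |supp(x_θ)| ≥ n(n+3)/2. -/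
open Finset Filter

noncomputable section

variable {Θ Ω A : Type*}

variable [Fintype Θ] [Fintype Ω] [Fintype A] [Nonempty A]

namespace QuadraticSupport

/-! ### The context

States are encoded by `y = q 1 - q 0 ∈ [-1, 1]`, so that the uniform prior is `y = 0`. Type `θ` has
indirect utility `gv n θ`, a maximum of affine functions indexed by the points `pt n i`. -/

/-- The grid `1, 1 - 1/n, …, 0`, followed by `-1` at index `n + 1`. -/
def pt (n i : ℕ) : ℝ := if i = n + 1 then -1 else 1 - i / n

/-- The gap between `y ^ 2` and its chord over `[-1, 1]` at a grid point. -/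
def gap (n i : ℕ) : ℝ := 1 - pt n i ^ 2

/-- The weight of the penalty terms in the recursive construction of the types. -/
def al (n : ℕ) : ℝ := 1 / (2 * (n : ℝ) ^ 3)

/-- The optimal price for type `θ`. -/
def price (n θ : ℕ) : ℝ := 1 - 1 / (2 * n) * ∑ i ∈ range (θ + 1), gap n i

/-- The penalty of type `θ` at a grid point; it vanishes on the signals intended for `θ`. -/
def drop (n θ i : ℕ) : ℝ :=
  if i ≤ θ ∨ i = n + 1 then 0 else if i = n then price n θ else gap n i

/-- The affine pieces at grid point `i`, averaged over the types `0, …, m`. -/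
def avgLine (n : ℕ) : ℕ → ℕ → ℝ → ℝ
  | 0, i, y => 2 * pt n i * y - pt n i ^ 2
  | m + 1, i, y => (avgLine n m i y +
      (al n * (price n (m + 1) - drop n (m + 1) i) + (1 - al n) * avgLine n m i y)) / 2

/-- The payoff of action `a` for type `θ`; only type `0` distinguishes the parity of `a`. -/
def line (n : ℕ) : ℕ → ℕ → ℝ → ℝ
  | 0, a, y => 2 * pt n (a / 2) * y - pt n (a / 2) ^ 2 +
      (if a % 2 = 0 then 1 else -1) * (1 / (2 * n)) * (y - pt n (a / 2))
  | m + 1, a, y =>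
      al n * (price n (m + 1) - drop n (m + 1) (a / 2)) + (1 - al n) * avgLine n m (a / 2) y

/-- The indirect utility of type `θ`. -/
def gv (n θ : ℕ) (y : ℝ) : ℝ :=
  univ.sup' univ_nonempty fun a : Fin (2 * n + 3 + 1) => line n θ a y

/-- The average of the indirect utilities of the types `0, …, m`. -/
def hv (n : ℕ) : ℕ → ℝ → ℝ
  | 0, y => gv n 0 y
  | m + 1, y => (hv n m y + gv n (m + 1) y) / 2

lemma al_pos {n : ℕ} (hn : 1 ≤ n) : 0 < al n := by
  have : (0 : ℝ) < n := by exact_mod_cast hn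
  unfold al; positivity

lemma al_mul {n : ℕ} (hn : 1 ≤ n) : 2 * al n * n = 1 / (n : ℝ) ^ 2 := by
  have : (0 : ℝ) < n := by exact_mod_cast hn
  unfold al; field_simp

lemma one_div_sq_le {n : ℕ} (hn : 1 ≤ n) : 1 / (n : ℝ) ^ 2 ≤ 1 := by
  have : (1 : ℝ) ≤ n := by exact_mod_cast hn
  rw [div_le_one (by positivity)]
  nlinarith

lemma al_le {n : ℕ} (hn : 1 ≤ n) : al n ≤ 1 / 2 := by
  have h : (1 : ℝ) ≤ n := by exact_mod_cast hn
  have h1 := al_mul hn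
  have h2 := one_div_sq_le hn
  nlinarith [al_pos hn]

lemma pt_zero (n : ℕ) : pt n 0 = 1 := by simp [pt]

lemma pt_last (n : ℕ) : pt n (n + 1) = -1 := by simp [pt]

lemma pt_self {n : ℕ} (hn : 1 ≤ n) : pt n n = 0 := by
  have : (n : ℝ) ≠ 0 := by positivity
  simp [pt, this]

lemma pt_mem_Ioo {n i : ℕ} (h1 : 1 ≤ i) (h2 : i < n) : 0 < pt n i ∧ pt n i < 1 := by
  have h : (0 : ℝ) < n := by exact_mod_cast (by omega : 0 < n)
  have hi : (0 : ℝ) < i := by exact_mod_cast h1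
  have hi' : (i : ℝ) < n := by exact_mod_cast h2
  rw [pt, if_neg (by omega)]
  have := (div_lt_one h).2 hi'
  have := div_pos hi h
  constructor <;> linarith

lemma pt_mem_Icc {n i : ℕ} (hn : 1 ≤ n) (hi : i ≤ n + 1) : -1 ≤ pt n i ∧ pt n i ≤ 1 := by
  rcases Nat.eq_zero_or_pos i with rfl | h0
  · rw [pt_zero]; norm_num
  rcases lt_trichotomy i n with h | rfl | h
  · have := pt_mem_Ioo h0 h
    constructor <;> linarith
  · rw [pt_self hn]; norm_num
  · obtain rfl : i = n + 1 := by omega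
    rw [pt_last]; norm_num

lemma pt_sep {n i j : ℕ} (hn : 1 ≤ n) (hi : i ≤ n + 1) (hj : j ≤ n + 1) (hij : i ≠ j) :
    1 / (n : ℝ) ≤ |pt n i - pt n j| := by
  have h : (1 : ℝ) ≤ n := by exact_mod_cast hn
  have h' : 1 / (n : ℝ) ≤ 1 := by rw [div_le_one (by positivity)]; exact h
  have key : ∀ a b : ℕ, a ≤ n + 1 → b ≤ n + 1 → a < b → 1 / (n : ℝ) ≤ pt n a - pt n b := by
    intro a b ha hb hab
    rw [pt, if_neg (by omega), pt]
    split_ifs with hb'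
    · have : (a : ℝ) / n ≤ 1 := by
        rw [div_le_one (by positivity)]
        exact_mod_cast (by omega : a ≤ n)
      linarith
    · have hab' : (a : ℝ) + 1 ≤ b := by exact_mod_cast hab
      have : ((a : ℝ) + 1) / n ≤ b / n := by gcongr
      rw [add_div] at this
      linarith
  rcases lt_or_gt_of_ne hij with hlt | hlt
  · exact (key i j hi hj hlt).trans (le_abs_self _)
  · rw [abs_sub_comm]
    exact (key j i hj hi hlt).trans (le_abs_self _)

lemma pt_sep_sq {n i j : ℕ} (hn : 1 ≤ n) (hi : i ≤ n + 1) (hj : j ≤ n + 1) (hij : i ≠ j) :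
    1 / (n : ℝ) ^ 2 ≤ (pt n i - pt n j) ^ 2 := by
  have h : (0 : ℝ) < n := by exact_mod_cast hn
  have := pt_sep hn hi hj hij
  rw [← sq_abs (pt n i - pt n j), ← one_div_pow]
  gcongr

lemma pt_inj {n i j : ℕ} (hn : 1 ≤ n) (hi : i ≤ n + 1) (hj : j ≤ n + 1)
    (h : pt n i = pt n j) : i = j := by
  by_contra hij
  have h0 : (0 : ℝ) < n := by exact_mod_cast hn
  have := pt_sep hn hi hj hij
  rw [h, sub_self, abs_zero] at this
  have : 0 < 1 / (n : ℝ) := by positivity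
  linarith

lemma gap_mem {n i : ℕ} (hn : 1 ≤ n) (hi : i ≤ n + 1) : 0 ≤ gap n i ∧ gap n i ≤ 1 := by
  have := pt_mem_Icc hn hi
  unfold gap
  constructor <;> nlinarith

lemma gap_pos {n i : ℕ} (h1 : 1 ≤ i) (h2 : i < n) : 0 < gap n i := by
  have := pt_mem_Ioo h1 h2
  unfold gap
  nlinarith

lemma gap_zero (n : ℕ) : gap n 0 = 0 := by simp [gap, pt_zero]

lemma gap_last (n : ℕ) : gap n (n + 1) = 0 := by simp [gap, pt_last]

lemma price_zero (n : ℕ) : price n 0 = 1 := by simp [price, gap_zero]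

lemma price_succ (n θ : ℕ) :
    price n (θ + 1) = price n θ - 1 / (2 * n) * gap n (θ + 1) := by
  rw [price, sum_range_succ, price]; ring

lemma price_anti {n j θ : ℕ} (hn : 1 ≤ n) (hj : j ≤ θ) (hθ : θ < n) :
    price n θ ≤ price n j := by
  induction θ, hj using Nat.le_induction with
  | base => exact le_rfl
  | succ k hk ih =>
    have h := (gap_mem hn (by omega : k + 1 ≤ n + 1)).1
    have : 0 ≤ 1 / (2 * (n : ℝ)) * gap n (k + 1) := by positivity
    rw [price_succ]
    linarith [ih (by omega)]

lemma price_pos {n θ : ℕ} (hn : 1 ≤ n) (hθ : θ < n) : 0 < price n θ := by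
  have h0 : (0 : ℝ) < n := by exact_mod_cast hn
  have hs : ∑ i ∈ range (θ + 1), gap n i ≤ n := by
    calc ∑ i ∈ range (θ + 1), gap n i ≤ ∑ i ∈ range (θ + 1), (1 : ℝ) := by
          refine sum_le_sum fun i hi => (gap_mem hn ?_).2
          have := mem_range.1 hi
          omega
      _ = ((θ + 1 : ℕ) : ℝ) := by simp
      _ ≤ n := by exact_mod_cast hθ
  have : 1 / (2 * (n : ℝ)) * ∑ i ∈ range (θ + 1), gap n i ≤ 1 / (2 * n) * n := by gcongr
  have h2 : 1 / (2 * (n : ℝ)) * n = 1 / 2 := by field_simp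
  unfold price
  linarith

lemma price_le_one {n θ : ℕ} (hn : 1 ≤ n) (hθ : θ < n) : price n θ ≤ 1 :=
  (price_anti hn (Nat.zero_le θ) hθ).trans_eq (price_zero n)

lemma drop_mem {n θ i : ℕ} (hn : 1 ≤ n) (hθ : θ < n) (hi : i ≤ n + 1) :
    0 ≤ drop n θ i ∧ drop n θ i ≤ 1 := by
  unfold drop
  split_ifs
  · norm_num
  · exact ⟨(price_pos hn hθ).le, price_le_one hn hθ⟩
  · exact gap_mem hn hi

lemma drop_pos {n θ i : ℕ} (hn : 1 ≤ n) (hθ : θ < n) (hi : i ≤ n + 1)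
    (h : ¬ (i ≤ θ ∨ i = n + 1)) : 0 < drop n θ i := by
  unfold drop
  rw [if_neg h]
  split_ifs
  · exact price_pos hn hθ
  · exact gap_pos (by omega) (by omega)

/-! ### Indirect utilities -/

lemma line_le_gv {n θ a : ℕ} (ha : a < 2 * n + 4) (y : ℝ) : line n θ a y ≤ gv n θ y :=
  le_sup' (fun a : Fin (2 * n + 3 + 1) => line n θ a y) (mem_univ (⟨a, ha⟩ : Fin (2 * n + 3 + 1)))

lemma exists_gv_eq (n θ : ℕ) (y : ℝ) : ∃ a < 2 * n + 4, gv n θ y = line n θ a y := by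
  obtain ⟨a, -, h⟩ := exists_mem_eq_sup' univ_nonempty
    fun a : Fin (2 * n + 3 + 1) => line n θ a y
  exact ⟨a, a.2, h⟩

lemma avgLine_affine (n m i : ℕ) (y : ℝ) :
    avgLine n m i y = (1 - y) / 2 * avgLine n m i (-1) + (1 + y) / 2 * avgLine n m i 1 := by
  induction m with
  | zero => simp only [avgLine]; ring
  | succ m ih => simp only [avgLine]; rw [ih]; ring

lemma line_affine (n θ a : ℕ) (y : ℝ) :
    line n θ a y = (1 - y) / 2 * line n θ a (-1) + (1 + y) / 2 * line n θ a 1 := by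
  cases θ with
  | zero => simp only [line]; ring
  | succ m => simp only [line]; rw [avgLine_affine n m (a / 2) y]; ring

lemma tangent_add_le_gv {n i : ℕ} (hn : 1 ≤ n) (hi : i ≤ n + 1) (y : ℝ) :
    avgLine n 0 i y + 1 / (2 * n) * |y - pt n i| ≤ gv n 0 y := by
  have h0 : (0 : ℝ) < n := by exact_mod_cast hn
  rcases le_total 0 (y - pt n i) with h | h
  · refine le_trans (le_of_eq ?_) (line_le_gv (a := 2 * i) (by omega) y)
    have h1 : 2 * i / 2 = i := by omega
    have h2 : 2 * i % 2 = 0 := by omega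
    simp only [line, avgLine, h1, h2, abs_of_nonneg h]
    simp
  · refine le_trans (le_of_eq ?_) (line_le_gv (a := 2 * i + 1) (by omega) y)
    have h1 : (2 * i + 1) / 2 = i := by omega
    have h2 : (2 * i + 1) % 2 = 1 := by omega
    simp only [line, avgLine, h1, h2, abs_of_nonpos h]
    simp
    ring

/-- At the grid points `gv n 0` agrees with `y ^ 2`. -/
lemma gv_zero_pt {n i : ℕ} (hn : 1 ≤ n) (hi : i ≤ n + 1) : gv n 0 (pt n i) = pt n i ^ 2 := by
  have h0 : (0 : ℝ) < n := by exact_mod_cast hn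
  apply le_antisymm
  · obtain ⟨a, ha, h⟩ := exists_gv_eq n 0 (pt n i)
    rw [h]
    by_cases hai : a / 2 = i
    · simp only [line, hai]
      ring_nf
      exact le_rfl
    · have hsep := pt_sep hn hi (by omega : a / 2 ≤ n + 1) (Ne.symm hai)
      set d := pt n i - pt n (a / 2) with hd
      have hs : (if a % 2 = 0 then 1 else -1 : ℝ) * (1 / (2 * n)) * d ≤ 1 / n * |d| := by
        have : 1 / (2 * (n : ℝ)) = 1 / n / 2 := by field_simp
        rw [this]
        have h1 : 0 < 1 / (n : ℝ) := by positivity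
        split_ifs
        · nlinarith [le_abs_self d, abs_nonneg d]
        · nlinarith [neg_abs_le d, abs_nonneg d]
      have : 1 / n * |d| ≤ d ^ 2 := by
        rw [← sq_abs, sq]; gcongr
      simp only [line]
      rw [← hd]
      have e : 2 * pt n (a / 2) * pt n i - pt n (a / 2) ^ 2 = pt n i ^ 2 - d ^ 2 := by
        rw [hd]; ring
      linarith
  · have := tangent_add_le_gv hn hi (pt n i)
    simp only [avgLine, sub_self, abs_zero, mul_zero, add_zero] at this
    linarith [sq (pt n i)]

lemma line_zero_le {n a : ℕ} (hn : 1 ≤ n) (ha : a < 2 * n + 4) :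
    line n 0 a (-1) ≤ 1 ∧ line n 0 a 1 ≤ 1 := by
  have h1 := gv_zero_pt hn (le_refl (n + 1))
  have h2 := gv_zero_pt hn (Nat.zero_le (n + 1))
  rw [pt_last] at h1
  rw [pt_zero] at h2
  have h3 := line_le_gv (θ := 0) ha (-1)
  have h4 := line_le_gv (θ := 0) ha 1
  norm_num at h1 h2
  constructor <;> linarith

lemma gv_zero_le {n : ℕ} (hn : 1 ≤ n) {y : ℝ} (h1 : -1 ≤ y) (h2 : y ≤ 1) : gv n 0 y ≤ 1 := by
  obtain ⟨a, ha, h⟩ := exists_gv_eq n 0 y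
  rw [h, line_affine]
  have := line_zero_le hn ha
  nlinarith

lemma gv_zero_lt {n : ℕ} (hn : 1 ≤ n) {y : ℝ} (h1 : -1 < y) (h2 : y < 1) : gv n 0 y < 1 := by
  obtain ⟨a, ha, h⟩ := exists_gv_eq n 0 y
  rw [h, line_affine]
  have h3 := line_zero_le hn ha
  have hn' : (1 : ℝ) ≤ n := by exact_mod_cast hn
  have hk : 0 < 1 / (2 * (n : ℝ)) ∧ 1 / (2 * (n : ℝ)) ≤ 1 / 2 := by
    refine ⟨by positivity, ?_⟩
    gcongr
    linarith
  have key : line n 0 a (-1) < 1 ∨ line n 0 a 1 < 1 := by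
    have hp := pt_mem_Icc hn (by omega : a / 2 ≤ n + 1)
    by_contra! hc
    obtain ⟨hc1, hc2⟩ := hc
    simp only [line] at hc1 hc2
    set p := pt n (a / 2)
    set k := 1 / (2 * (n : ℝ))
    split_ifs at hc1 hc2 <;> nlinarith [sq_nonneg p]
  rcases key with h | h <;> nlinarith

lemma avgLine_succ {n m i : ℕ} (y : ℝ) :
    avgLine n (m + 1) i y = (avgLine n m i y + line n (m + 1) (2 * i) y) / 2 := by
  have : 2 * i / 2 = i := by omega
  simp only [avgLine, line, this]

lemma avgLine_le_hv {n m i : ℕ} (hn : 1 ≤ n) (hi : i ≤ n + 1) (y : ℝ) :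
    avgLine n m i y ≤ hv n m y := by
  induction m with
  | zero =>
    have := tangent_add_le_gv hn hi y
    have : 0 ≤ 1 / (2 * (n : ℝ)) * |y - pt n i| := by positivity
    simp only [hv]
    linarith
  | succ m ih =>
    have := line_le_gv (θ := m + 1) (by omega : 2 * i < 2 * n + 4) y
    rw [avgLine_succ, hv]
    linarith

lemma avgLine_lt_hv {n m i : ℕ} (hn : 1 ≤ n) (hi : i ≤ n + 1) {y : ℝ} (hy : y ≠ pt n i) :
    avgLine n m i y < hv n m y := by
  induction m with
  | zero =>
    have h0 : (0 : ℝ) < n := by exact_mod_cast hn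
    have := tangent_add_le_gv hn hi y
    have : 0 < |y - pt n i| := abs_pos.2 (sub_ne_zero.2 hy)
    have : 0 < 1 / (2 * (n : ℝ)) * |y - pt n i| := by positivity
    simp only [hv]
    linarith
  | succ m ih =>
    have := line_le_gv (θ := m + 1) (by omega : 2 * i < 2 * n + 4) y
    rw [avgLine_succ, hv]
    linarith

lemma gv_succ_le {n m : ℕ} (hn : 1 ≤ n) (hm : m + 1 < n) (y : ℝ) :
    gv n (m + 1) y ≤ al n * price n (m + 1) + (1 - al n) * hv n m y := by
  obtain ⟨a, ha, h⟩ := exists_gv_eq n (m + 1) y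
  have hi : a / 2 ≤ n + 1 := by omega
  rw [h, line]
  have h1 := avgLine_le_hv (m := m) hn hi y
  have h2 := (drop_mem hn hm hi).1
  nlinarith [al_pos hn, al_le hn]

lemma eq_pt_of_gv_succ_eq {n m : ℕ} (hn : 1 ≤ n) (hm : m + 1 < n) {y : ℝ}
    (hy : gv n (m + 1) y = al n * price n (m + 1) + (1 - al n) * hv n m y) :
    ∃ i, (i ≤ m + 1 ∨ i = n + 1) ∧ y = pt n i := by
  obtain ⟨a, ha, h⟩ := exists_gv_eq n (m + 1) y
  have hi : a / 2 ≤ n + 1 := by omega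
  rw [h, line] at hy
  have h1 := avgLine_le_hv (m := m) hn hi y
  have h2 := (drop_mem hn hm hi).1
  have h3 := al_pos hn
  have h4 := al_le hn
  refine ⟨a / 2, ?_, ?_⟩
  · by_contra hc
    have := drop_pos hn hm hi hc
    nlinarith
  · by_contra hc
    have := avgLine_lt_hv (m := m) hn hi hc
    nlinarith

lemma avgLine_sub_le {n m i j : ℕ} (hn : 1 ≤ n) (hm : m < n) (hi : i ≤ n + 1) (hj : j ≤ n + 1)
    (hij : i ≠ j) :
    avgLine n m j (pt n i) - avgLine n m i (pt n i) ≤ -(1 / (n : ℝ) ^ 2) + 2 * al n * m := by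
  induction m with
  | zero =>
    have := pt_sep_sq hn hi hj hij
    simp only [avgLine, Nat.cast_zero, mul_zero, add_zero]
    linarith
  | succ m ih =>
    have ih := ih (by omega)
    have h1 := al_pos hn
    have h2 := al_le hn
    have h3 := (drop_mem hn hm hi).2
    have h4 := (drop_mem hn hm hj).1
    have h5 := one_div_sq_le hn
    have h6 : (0 : ℝ) ≤ m := by positivity
    simp only [avgLine]
    push_cast
    set D := avgLine n m j (pt n i) - avgLine n m i (pt n i) with hD
    have e : (avgLine n m j (pt n i) + (al n * (price n (m + 1) - drop n (m + 1) j) +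
          (1 - al n) * avgLine n m j (pt n i))) / 2 -
        (avgLine n m i (pt n i) + (al n * (price n (m + 1) - drop n (m + 1) i) +
          (1 - al n) * avgLine n m i (pt n i))) / 2 =
        (1 - al n / 2) * D + al n / 2 * (drop n (m + 1) i - drop n (m + 1) j) := by
      rw [hD]; ring
    rw [e]
    have h7 : (1 - al n / 2) * D ≤ (1 - al n / 2) * (-(1 / (n : ℝ) ^ 2) + 2 * al n * m) := by
      gcongr
      linarith
    have h8 : al n / 2 * (drop n (m + 1) i - drop n (m + 1) j) ≤ al n / 2 * 1 := by
      gcongr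
      linarith
    nlinarith [mul_nonneg h1.le (mul_nonneg h1.le h6)]

lemma gv_succ_pt_eq_line {n m i : ℕ} (hn : 1 ≤ n) (hm : m + 1 < n) (hi : i ≤ n + 1) :
    gv n (m + 1) (pt n i) = line n (m + 1) (2 * i) (pt n i) := by
  apply le_antisymm
  · obtain ⟨a, ha, h⟩ := exists_gv_eq n (m + 1) (pt n i)
    have ha' : a / 2 ≤ n + 1 := by omega
    have h2i : 2 * i / 2 = i := by omega
    rw [h]
    simp only [line, h2i]
    by_cases hai : i = a / 2
    · rw [hai]
    · have h0 := avgLine_sub_le hn (by omega : m < n) hi ha' hai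
      have h1 := al_pos hn
      have h2 := al_le hn
      have h3 := (drop_mem hn hm hi).2
      have h4 := (drop_mem hn hm ha').1
      have h5 := al_mul hn
      have h6 : (m : ℝ) + 1 ≤ n := by exact_mod_cast hm.le
      have h7 := mul_le_mul_of_nonneg_left h6 h1.le
      have h8 : al n * (drop n (m + 1) i - drop n (m + 1) (a / 2)) ≤ al n * 1 := by
        gcongr
        linarith
      set D := avgLine n m (a / 2) (pt n i) - avgLine n m i (pt n i) with hD
      have h9 : D ≤ -(2 * al n) := by linarith
      have h10 : (1 - al n) * D ≤ 1 / 2 * -(2 * al n) := by nlinarith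
      rw [hD] at h10
      linarith
  · exact line_le_gv (by omega) _

lemma hv_pt {n m i : ℕ} (hn : 1 ≤ n) (hm : m < n) (hi : i ≤ n + 1) :
    hv n m (pt n i) = avgLine n m i (pt n i) := by
  induction m with
  | zero => rw [hv, gv_zero_pt hn hi, avgLine]; ring
  | succ m ih => rw [avgLine_succ, hv, ih (by omega), gv_succ_pt_eq_line hn hm hi]

lemma gv_succ_pt {n m i : ℕ} (hn : 1 ≤ n) (hm : m + 1 < n) (hi : i ≤ n + 1) :
    gv n (m + 1) (pt n i) =
      al n * (price n (m + 1) - drop n (m + 1) i) + (1 - al n) * hv n m (pt n i) := by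
  have h2i : 2 * i / 2 = i := by omega
  rw [gv_succ_pt_eq_line hn hm hi, hv_pt hn (by omega) hi, line, h2i]

lemma gv_hv_zero {n θ : ℕ} (hn : 1 ≤ n) (hθ : θ < n) : gv n θ 0 = 0 ∧ hv n θ 0 = 0 := by
  have hp := pt_self hn
  induction θ with
  | zero =>
    have := gv_zero_pt hn (by omega : n ≤ n + 1)
    rw [hp] at this
    norm_num at this
    exact ⟨this, this⟩
  | succ m ih =>
    have h := gv_succ_pt hn hθ (by omega : n ≤ n + 1)
    have hd : drop n (m + 1) n = price n (m + 1) := by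
      rw [drop, if_neg (by omega), if_pos rfl]
    rw [hp, hd, (ih (by omega)).2] at h
    rw [hv, (ih (by omega)).2, h]
    norm_num

/-! ### Expectations -/

/-- The expectation of `f (q 1 - q 0)` when the posterior `q` is distributed according to `x`. -/
def ex (x : (Fin 2 → ℝ) →₀ ℝ) (f : ℝ → ℝ) : ℝ := ∑ q ∈ x.support, x q * f (q 1 - q 0)

/-- Feasibility for the uniform prior on two states. -/
abbrev Feas (x : (Fin 2 → ℝ) →₀ ℝ) : Prop := FeasRep (fun _ => 1 / 2) x

lemma IsDist.diff_mem {q : Fin 2 → ℝ} (h : IsDist q) : -1 ≤ q 1 - q 0 ∧ q 1 - q 0 ≤ 1 := by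
  obtain ⟨h1, h2⟩ := h
  rw [Fin.sum_univ_two] at h2
  have := h1 0
  have := h1 1
  constructor <;> linarith

lemma ex_comb (x : (Fin 2 → ℝ) →₀ ℝ) (a b : ℝ) (f g : ℝ → ℝ) :
    ex x (fun y => a * f y + b * g y) = a * ex x f + b * ex x g := by
  simp only [ex, mul_sum, ← sum_add_distrib]
  exact sum_congr rfl fun q _ => by ring

lemma ex_const {x : (Fin 2 → ℝ) →₀ ℝ} (hx : Feas x) (c : ℝ) : ex x (fun _ => c) = c := by
  rw [ex, ← sum_mul, hx.2.2.1, one_mul]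

lemma ex_id {x : (Fin 2 → ℝ) →₀ ℝ} (hx : Feas x) : ex x (fun y => y) = 0 := by
  have h := hx.2.2.2
  simp only [ex, mul_sub, sum_sub_distrib, h, sub_self]

lemma ex_mono {x : (Fin 2 → ℝ) →₀ ℝ} (hx : Feas x) {f g : ℝ → ℝ}
    (h : ∀ y, -1 ≤ y → y ≤ 1 → f y ≤ g y) : ex x f ≤ ex x g := by
  refine sum_le_sum fun q hq => mul_le_mul_of_nonneg_left ?_ (hx.2.1 q)
  have := IsDist.diff_mem (hx.1 q hq)
  exact h _ this.1 this.2

lemma eq_of_ex_eq {x : (Fin 2 → ℝ) →₀ ℝ} (hx : Feas x) {f g : ℝ → ℝ}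
    (h : ∀ y, -1 ≤ y → y ≤ 1 → f y ≤ g y) (he : ex x f = ex x g) {q : Fin 2 → ℝ}
    (hq : q ∈ x.support) : f (q 1 - q 0) = g (q 1 - q 0) := by
  have h1 : ∀ q ∈ x.support, x q * f (q 1 - q 0) ≤ x q * g (q 1 - q 0) := by
    refine fun q hq => mul_le_mul_of_nonneg_left ?_ (hx.2.1 q)
    have := IsDist.diff_mem (hx.1 q hq)
    exact h _ this.1 this.2
  exact mul_left_cancel₀ (Finsupp.mem_support_iff.1 hq) ((sum_eq_sum_iff_of_le h1).1 he q hq)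

lemma ex_hv_succ (x : (Fin 2 → ℝ) →₀ ℝ) (n m : ℕ) :
    ex x (hv n (m + 1)) = (ex x (hv n m) + ex x (gv n (m + 1))) / 2 := by
  have : hv n (m + 1) = fun y => 1 / 2 * hv n m y + 1 / 2 * gv n (m + 1) y := by
    funext y; rw [hv]; ring
  rw [this, ex_comb]
  ring

lemma ex_upper {x : (Fin 2 → ℝ) →₀ ℝ} (hx : Feas x) (n m : ℕ) :
    ex x (fun y => al n * price n (m + 1) + (1 - al n) * hv n m y) =
      al n * price n (m + 1) + (1 - al n) * ex x (hv n m) := by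
  rw [ex_comb x (al n) (1 - al n) (fun _ => price n (m + 1)), ex_const hx]

lemma ex_gv_succ_le {n m : ℕ} (hn : 1 ≤ n) (hm : m + 1 < n) {x : (Fin 2 → ℝ) →₀ ℝ}
    (hx : Feas x) :
    ex x (gv n (m + 1)) ≤ al n * price n (m + 1) + (1 - al n) * ex x (hv n m) := by
  rw [← ex_upper hx]
  exact ex_mono hx fun y _ _ => gv_succ_le hn hm y

/-! ### The revenue bound -/

section Bound

variable {n : ℕ} {X : ℕ → (Fin 2 → ℝ) →₀ ℝ} {t : ℕ → ℝ}

lemma ex_hv_le_rents (hIR : ∀ θ < n, 0 ≤ ex (X θ) (gv n θ) - t θ)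
    (hIC : ∀ j < n, ∀ θ < n, ex (X θ) (gv n j) - t θ ≤ ex (X j) (gv n j) - t j)
    {m θ : ℕ} (hm : m < n) (hθ : θ < n) :
    ex (X θ) (hv n m) ≤ t θ + ∑ j ∈ range (m + 1), (ex (X j) (gv n j) - t j) := by
  induction m with
  | zero =>
    have := hIC 0 hm θ hθ
    simp only [zero_add, range_one, sum_singleton]
    change ex (X θ) (gv n 0) ≤ _
    linarith
  | succ m ih =>
    have h1 := ih (by omega)
    have h2 := hIC (m + 1) hm θ hθ
    have h3 := hIR (m + 1) hm
    have h4 : 0 ≤ ∑ j ∈ range (m + 1), (ex (X j) (gv n j) - t j) :=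
      sum_nonneg fun j hj => hIR j (by have := mem_range.1 hj; omega)
    rw [ex_hv_succ, sum_range_succ]
    linarith

lemma price_bound (hn : 1 ≤ n) (hX : ∀ θ < n, Feas (X θ))
    (hIR : ∀ θ < n, 0 ≤ ex (X θ) (gv n θ) - t θ)
    (hIC : ∀ j < n, ∀ θ < n, ex (X θ) (gv n j) - t θ ≤ ex (X j) (gv n j) - t j)
    {θ : ℕ} (hθ : θ < n) :
    t θ - price n θ ≤ 1 / al n * (∑ j ∈ range θ, (ex (X j) (gv n j) - t j)) -
      (ex (X θ) (gv n θ) - t θ) := by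
  have ha := al_pos hn
  have ha' := al_le hn
  cases θ with
  | zero =>
    have h1 : ex (X 0) (gv n 0) ≤ ex (X 0) (fun _ => 1) :=
      ex_mono (hX 0 hθ) fun y h h' => gv_zero_le hn h h'
    rw [ex_const (hX 0 hθ)] at h1
    rw [price_zero, range_zero, sum_empty]
    linarith
  | succ m =>
    have h1 := ex_gv_succ_le hn hθ (hX _ hθ)
    have h2 := ex_hv_le_rents hIR hIC (by omega : m < n) hθ
    have h3 := hIR _ hθ
    have h4 : 0 ≤ ∑ j ∈ range (m + 1), (ex (X j) (gv n j) - t j) :=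
      sum_nonneg fun j hj => hIR j (by have := mem_range.1 hj; omega)
    set S := ∑ j ∈ range (m + 1), (ex (X j) (gv n j) - t j)
    set U := ex (X (m + 1)) (gv n (m + 1)) - t (m + 1) with hU
    have h5 : (1 - al n) * ex (X (m + 1)) (hv n m) ≤ (1 - al n) * (t (m + 1) + S) := by
      gcongr
      linarith
    have h6 : al n * (t (m + 1) - price n (m + 1)) ≤ S - al n * U := by nlinarith
    have h7 : al n * (1 / al n * S - U) = S - al n * U := by field_simp
    rw [← h7] at h6
    exact le_of_mul_le_mul_left h6 ha

lemma revenue_bound (hn : 1 ≤ n) (hX : ∀ θ < n, Feas (X θ))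
    (hIR : ∀ θ < n, 0 ≤ ex (X θ) (gv n θ) - t θ)
    (hIC : ∀ j < n, ∀ θ < n, ex (X θ) (gv n j) - t θ ≤ ex (X j) (gv n j) - t j)
    {N : ℕ} (hN : N ≤ n) :
    ∑ θ ∈ range N, (al n / 2) ^ θ * (t θ - price n θ) ≤
      -((1 / al n + 1) * (al n / 2) ^ N * ∑ j ∈ range N, (ex (X j) (gv n j) - t j)) := by
  have ha := al_pos hn
  have ha' := al_le hn
  induction N with
  | zero => simp
  | succ N ih =>
    have ih := ih (by omega)
    have h1 := price_bound hn hX hIR hIC (by omega : N < n)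
    have h2 : (al n / 2) ^ N * (t N - price n N) ≤ (al n / 2) ^ N * _ :=
      mul_le_mul_of_nonneg_left h1 (by positivity)
    have h3 := hIR N (by omega)
    have h4 : 0 ≤ ∑ j ∈ range N, (ex (X j) (gv n j) - t j) :=
      sum_nonneg fun j hj => hIR j (by have := mem_range.1 hj; omega)
    rw [sum_range_succ, sum_range_succ, pow_succ]
    set S := ∑ j ∈ range N, (ex (X j) (gv n j) - t j)
    set U := ex (X N) (gv n N) - t N
    set b := (al n / 2) ^ N
    have hb : 0 < b := by positivity
    have h5 : (1 / al n + 1) * (b * (al n / 2)) = b * (1 / 2 + al n / 2) := by field_simp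
    rw [h5]
    have h6 : b * (1 / 2 + al n / 2) * (S + U) ≤ b * 1 * (S + U) := by
      gcongr
      linarith
    linarith

end Bound

lemma eq_price_of_optimal {n : ℕ} {X : ℕ → (Fin 2 → ℝ) →₀ ℝ} {t : ℕ → ℝ} (hn : 1 ≤ n)
    (hX : ∀ θ < n, Feas (X θ))
    (hIR : ∀ θ < n, 0 ≤ ex (X θ) (gv n θ) - t θ)
    (hIC : ∀ j < n, ∀ θ < n, ex (X θ) (gv n j) - t θ ≤ ex (X j) (gv n j) - t j)
    (hopt : ∑ θ ∈ range n, (al n / 2) ^ θ * t θ = ∑ θ ∈ range n, (al n / 2) ^ θ * price n θ) :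
    ∀ θ < n, ex (X θ) (gv n θ) = price n θ ∧ t θ = price n θ := by
  have ha := al_pos hn
  have h0 : ∑ θ ∈ range n, (al n / 2) ^ θ * (t θ - price n θ) = 0 := by
    simp only [mul_sub, sum_sub_distrib, hopt, sub_self]
  have hb := revenue_bound hn hX hIR hIC le_rfl
  have hIR' : ∀ j ∈ range n, 0 ≤ ex (X j) (gv n j) - t j := fun j hj => hIR j (mem_range.1 hj)
  have hS : ∑ j ∈ range n, (ex (X j) (gv n j) - t j) = 0 := by
    have h1 : 0 < (1 / al n + 1) * (al n / 2) ^ n := by positivity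
    have h2 := sum_nonneg hIR'
    rw [h0] at hb
    nlinarith
  have hU : ∀ j < n, ex (X j) (gv n j) - t j = 0 := fun j hj =>
    (sum_eq_zero_iff_of_nonneg hIR').1 hS j (mem_range.2 hj)
  have hle : ∀ θ ∈ range n, (al n / 2) ^ θ * (t θ - price n θ) ≤ 0 := by
    intro θ hθ
    have hθ := mem_range.1 hθ
    have h := price_bound hn hX hIR hIC hθ
    rw [hU θ hθ, sum_eq_zero fun j hj => hU j ((mem_range.1 hj).trans hθ)] at h
    have : 0 < (al n / 2) ^ θ := by positivity
    nlinarith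
  intro θ hθ
  have h1 := (sum_eq_zero_iff_of_nonpos hle).1 h0 θ (mem_range.2 hθ)
  have h2 : t θ = price n θ := by
    rcases mul_eq_zero.1 h1 with h | h
    · exact absurd h (by positivity)
    · linarith
  have := hU θ hθ
  exact ⟨by linarith, h2⟩

/-! ### Signals supported on the grid -/

/-- The indices of the posteriors used by type `θ`. -/
def idx (n θ : ℕ) : Finset ℕ := insert (n + 1) (range (θ + 1))

lemma mem_idx {n θ i : ℕ} : i ∈ idx n θ ↔ i ≤ θ ∨ i = n + 1 := by
  rw [idx, mem_insert, mem_range]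
  omega

lemma le_of_mem_idx {n θ i : ℕ} (hθ : θ < n) (hi : i ∈ idx n θ) : i ≤ n + 1 := by
  rw [mem_idx] at hi
  omega

lemma card_idx {n θ : ℕ} (hθ : θ < n) : #(idx n θ) = θ + 2 := by
  rw [idx, card_insert_of_notMem (by rw [mem_range]; omega), card_range]

lemma sum_idx {n θ : ℕ} (hθ : θ < n) (f : ℕ → ℝ) :
    ∑ i ∈ idx n θ, f i = f (n + 1) + (f 0 + ∑ i ∈ range θ, f (i + 1)) := by
  rw [idx, sum_insert (by rw [mem_range]; omega), sum_range_succ', add_comm (f 0)]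

/-- The posterior at grid point `i`. -/
def post (n i : ℕ) : Fin 2 → ℝ := ![(1 - pt n i) / 2, (1 + pt n i) / 2]

lemma post_diff (n i : ℕ) : post n i 1 - post n i 0 = pt n i := by
  simp only [post, Matrix.cons_val_zero, Matrix.cons_val_one]
  ring

lemma isDist_post {n i : ℕ} (hn : 1 ≤ n) (hi : i ≤ n + 1) : IsDist (post n i) := by
  have := pt_mem_Icc hn hi
  refine ⟨fun ω => ?_, ?_⟩
  · fin_cases ω <;> simp [post] <;> linarith
  · simp only [Fin.sum_univ_two, post, Matrix.cons_val_zero, Matrix.cons_val_one]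
    ring

lemma eq_post {n i : ℕ} {q : Fin 2 → ℝ} (hq : IsDist q) (h : q 1 - q 0 = pt n i) :
    q = post n i := by
  have h2 := hq.2
  rw [Fin.sum_univ_two] at h2
  funext ω
  fin_cases ω
  · simp [post]; linarith
  · simp [post]; linarith

lemma post_injOn {n θ : ℕ} (hn : 1 ≤ n) (hθ : θ < n) : Set.InjOn (post n) (idx n θ) := by
  intro i hi j hj h
  apply pt_inj hn (le_of_mem_idx hθ hi) (le_of_mem_idx hθ hj)
  rw [← post_diff, ← post_diff, h]

lemma ex_eq_sum_idx {n θ : ℕ} (hn : 1 ≤ n) (hθ : θ < n) {x : (Fin 2 → ℝ) →₀ ℝ}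
    (hs : x.support ⊆ (idx n θ).image (post n)) (f : ℝ → ℝ) :
    ex x f = ∑ i ∈ idx n θ, x (post n i) * f (pt n i) := by
  rw [ex, sum_subset hs fun q _ hq => by rw [Finsupp.notMem_support_iff.1 hq, zero_mul],
    sum_image (post_injOn hn hθ)]
  simp only [post_diff]

lemma drop_zero {n θ i : ℕ} (hθ : θ < n) (hi : i ∈ idx n θ) : drop n 0 i = gap n i := by
  rw [mem_idx] at hi
  unfold drop
  split_ifs with h1 h2
  · rcases h1 with h | rfl
    · rw [Nat.le_zero.1 h, gap_zero]
    · rw [gap_last]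
  · omega
  · rfl

lemma drop_eq_drop_succ {n j θ i : ℕ} (hj : j < θ) (hθ : θ < n) (hi : i ∈ idx n θ) :
    drop n j i = drop n (j + 1) i + if i = j + 1 then gap n (j + 1) else 0 := by
  rw [mem_idx] at hi
  unfold drop
  by_cases h : i = j + 1
  · subst h
    rw [if_neg (by omega), if_neg (by omega), if_pos (by omega), if_pos rfl, zero_add]
  · rw [if_neg h, add_zero]
    by_cases h1 : i ≤ j ∨ i = n + 1
    · rw [if_pos h1, if_pos (by omega)]
    · rw [if_neg h1, if_neg (by omega), if_neg (by omega), if_neg (by omega)]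

lemma sum_drop {n j θ : ℕ} (hj : j < θ) (hθ : θ < n) (a : ℕ → ℝ) :
    ∑ i ∈ idx n θ, a i * drop n j i =
      ∑ i ∈ idx n θ, a i * drop n (j + 1) i + a (j + 1) * gap n (j + 1) := by
  have hmem : j + 1 ∈ idx n θ := mem_idx.2 (by omega)
  rw [sum_congr rfl fun i hi => by rw [drop_eq_drop_succ hj hθ hi, mul_add], sum_add_distrib]
  simp only [mul_ite, mul_zero, sum_ite_eq' (idx n θ), if_pos hmem]

lemma sum_drop_self {n θ : ℕ} (a : ℕ → ℝ) : ∑ i ∈ idx n θ, a i * drop n θ i = 0 :=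
  sum_eq_zero fun i hi => by rw [drop, if_pos (mem_idx.1 hi), mul_zero]

lemma ex_gv_zero_idx {n θ : ℕ} (hn : 1 ≤ n) (hθ : θ < n) {x : (Fin 2 → ℝ) →₀ ℝ} (hx : Feas x)
    (hs : x.support ⊆ (idx n θ).image (post n)) :
    ex x (gv n 0) = 1 - ∑ i ∈ idx n θ, x (post n i) * drop n 0 i := by
  have h1 := ex_const hx 1
  rw [ex_eq_sum_idx hn hθ hs] at h1 ⊢
  rw [eq_sub_iff_add_eq, ← h1, ← sum_add_distrib]
  refine sum_congr rfl fun i hi => ?_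
  rw [drop_zero hθ hi, gv_zero_pt hn (le_of_mem_idx hθ hi), gap]
  ring

lemma ex_gv_succ_idx {n m θ : ℕ} (hn : 1 ≤ n) (hm : m + 1 < n) (hθ : θ < n)
    {x : (Fin 2 → ℝ) →₀ ℝ} (hx : Feas x) (hs : x.support ⊆ (idx n θ).image (post n)) :
    ex x (gv n (m + 1)) =
      al n * price n (m + 1) + (1 - al n) * ex x (hv n m) -
        al n * ∑ i ∈ idx n θ, x (post n i) * drop n (m + 1) i := by
  rw [← ex_upper hx, ex_eq_sum_idx hn hθ hs, ex_eq_sum_idx hn hθ hs, mul_sum, ← sum_sub_distrib]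
  refine sum_congr rfl fun i hi => ?_
  rw [gv_succ_pt hn hm (le_of_mem_idx hθ hi)]
  ring

/-! ### Optimal signals have large support -/

lemma ex_hv_le {n m : ℕ} {x : (Fin 2 → ℝ) →₀ ℝ} {c : ℝ} (h : ∀ j ≤ m, ex x (gv n j) ≤ c) :
    ex x (hv n m) ≤ c := by
  induction m with
  | zero => exact h 0 le_rfl
  | succ m ih =>
    rw [ex_hv_succ]
    linarith [ih fun j hj => h j (by omega), h (m + 1) le_rfl]

lemma ex_eq_of_ex_hv_eq {n m : ℕ} {x : (Fin 2 → ℝ) →₀ ℝ} {c : ℝ}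
    (h : ∀ j ≤ m, ex x (gv n j) ≤ c) (hm : ex x (hv n m) = c) :
    ∀ j ≤ m, ex x (gv n j) = c ∧ ex x (hv n j) = c := by
  induction m with
  | zero =>
    intro j hj
    obtain rfl := Nat.le_zero.1 hj
    exact ⟨hm, hm⟩
  | succ m ih =>
    have h1 := ex_hv_le fun j hj => h j (by omega : j ≤ m + 1)
    have h2 := h (m + 1) le_rfl
    have hm' := hm
    rw [ex_hv_succ] at hm'
    have h3 := ex_hv_le (m := m) fun j hj => h j (by omega)
    intro j hj
    rcases Nat.lt_or_ge m j with hj' | hj'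
    · obtain rfl : j = m + 1 := by omega
      exact ⟨by linarith, hm⟩
    · exact ih (fun j hj => h j (by omega)) (by linarith) j hj'

lemma optimal_signal {n θ : ℕ} (hn : 1 ≤ n) (hθ : θ < n) {x : (Fin 2 → ℝ) →₀ ℝ} (hx : Feas x)
    (hle : ∀ j < n, ex x (gv n j) ≤ price n θ) (heq : ex x (gv n θ) = price n θ) :
    x.support ⊆ (idx n θ).image (post n) ∧
      ∀ j < θ, ex x (gv n j) = price n θ ∧ ex x (hv n j) = price n θ := by
  have key : ∀ q ∈ x.support, (∃ i, (i ≤ θ ∨ i = n + 1) ∧ q 1 - q 0 = pt n i) →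
      q ∈ (idx n θ).image (post n) := by
    rintro q hq ⟨i, hi, h⟩
    exact mem_image.2 ⟨i, mem_idx.2 hi, (eq_post (hx.1 q hq) h).symm⟩
  cases θ with
  | zero =>
    refine ⟨fun q hq => key q hq ?_, fun j hj => absurd hj (Nat.not_lt_zero j)⟩
    rw [price_zero, ← ex_const hx 1] at heq
    have h := eq_of_ex_eq hx (fun y h h' => gv_zero_le hn h h') heq hq
    have hq' := IsDist.diff_mem (hx.1 q hq)
    by_cases h1 : q 1 - q 0 = -1
    · exact ⟨n + 1, Or.inr rfl, by rw [h1, pt_last]⟩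
    by_cases h2 : q 1 - q 0 = 1
    · exact ⟨0, Or.inl le_rfl, by rw [h2, pt_zero]⟩
    exact absurd h (gv_zero_lt hn (lt_of_le_of_ne hq'.1 (Ne.symm h1))
      (lt_of_le_of_ne hq'.2 h2)).ne
  | succ m =>
    have ha := al_pos hn
    have ha' := al_le hn
    have hj : ∀ j ≤ m, ex x (gv n j) ≤ price n (m + 1) := fun j hj => hle j (by omega)
    have h1 := ex_hv_le hj
    have h2 := ex_gv_succ_le hn hθ hx
    have h3 : ex x (hv n m) = price n (m + 1) := by
      apply le_antisymm h1
      nlinarith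
    refine ⟨fun q hq => key q hq ?_,
      fun j hj' => ex_eq_of_ex_hv_eq hj h3 j (Nat.lt_succ_iff.1 hj')⟩
    refine eq_pt_of_gv_succ_eq hn hθ (eq_of_ex_eq hx (fun y _ _ => gv_succ_le hn hθ y) ?_ hq)
    rw [ex_upper hx, h3, heq]
    ring

lemma sum_drop_optimal {n θ : ℕ} (hn : 1 ≤ n) (hθ : θ < n) {x : (Fin 2 → ℝ) →₀ ℝ} (hx : Feas x)
    (hle : ∀ j < n, ex x (gv n j) ≤ price n θ) (heq : ex x (gv n θ) = price n θ)
    {j : ℕ} (hj : j ≤ θ) :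
    ∑ i ∈ idx n θ, x (post n i) * drop n j i = price n j - price n θ := by
  obtain ⟨hs, h⟩ := optimal_signal hn hθ hx hle heq
  have h1 : ex x (gv n j) = price n θ := by
    rcases hj.lt_or_eq with hj | rfl
    exacts [(h j hj).1, heq]
  have ha := al_pos hn
  cases j with
  | zero =>
    rw [ex_gv_zero_idx hn hθ hx hs] at h1
    rw [price_zero]
    linarith
  | succ m =>
    rw [ex_gv_succ_idx hn (by omega) hθ hx hs, (h m (by omega)).2] at h1
    apply mul_left_cancel₀ ha.ne'
    linarith

lemma optimal_weight {n θ : ℕ} (hn : 1 ≤ n) (hθ : θ < n) {x : (Fin 2 → ℝ) →₀ ℝ} (hx : Feas x)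
    (hle : ∀ j < n, ex x (gv n j) ≤ price n θ) (heq : ex x (gv n θ) = price n θ)
    {j : ℕ} (hj : j < θ) : x (post n (j + 1)) = 1 / (2 * n) := by
  have h1 := sum_drop_optimal hn hθ hx hle heq hj.le
  have h2 := sum_drop_optimal hn hθ hx hle heq hj
  have h3 := sum_drop hj hθ fun i => x (post n i)
  rw [Nat.succ_eq_add_one] at h2
  rw [h1, h2, price_succ] at h3
  apply mul_right_cancel₀ (gap_pos (by omega) (by omega : j + 1 < n)).ne'
  linarith

/-- The mass of the posteriors `1` and `-1` is positive. -/
lemma extreme_mass_pos {n θ : ℕ} (hθ : θ < n) {a b : ℝ}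
    (h1 : b + (a + ∑ _i ∈ range θ, 1 / (2 * (n : ℝ))) = 1)
    (h2 : -b + (a + ∑ i ∈ range θ, 1 / (2 * n) * pt n (i + 1)) = 0) : 0 < a ∧ 0 < b := by
  have h0 : (0 : ℝ) < n := by exact_mod_cast (by omega : 0 < n)
  have hs : 0 < 1 / (2 * (n : ℝ)) := by positivity
  have hp : ∀ i ∈ range θ, 0 < pt n (i + 1) ∧ pt n (i + 1) < 1 := fun i hi =>
    pt_mem_Ioo (by omega) (by have := mem_range.1 hi; omega)
  have h3 : 0 ≤ ∑ i ∈ range θ, 1 / (2 * n) * pt n (i + 1) :=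
    sum_nonneg fun i hi => mul_nonneg hs.le (hp i hi).1.le
  have h4 : ∑ i ∈ range θ, 1 / (2 * n) * pt n (i + 1) ≤ ∑ i ∈ range θ, 1 / (2 * (n : ℝ)) :=
    sum_le_sum fun i hi => mul_le_of_le_one_right hs.le (hp i hi).2.le
  have h5 : ∑ i ∈ range θ, 1 / (2 * (n : ℝ)) < 1 / 2 := by
    rw [sum_const, card_range, nsmul_eq_mul, mul_one_div, div_lt_div_iff₀ (by positivity) two_pos]
    have : (θ : ℝ) < n := by exact_mod_cast hθ
    linarith
  constructor <;> linarith

lemma card_support_optimal {n θ : ℕ} (hn : 1 ≤ n) (hθ : θ < n) {x : (Fin 2 → ℝ) →₀ ℝ}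
    (hx : Feas x) (hle : ∀ j < n, ex x (gv n j) ≤ price n θ)
    (heq : ex x (gv n θ) = price n θ) : θ + 2 ≤ #x.support := by
  have hs := (optimal_signal hn hθ hx hle heq).1
  have hw : ∀ i ∈ range θ, x (post n (i + 1)) = 1 / (2 * n) := fun i hi =>
    optimal_weight hn hθ hx hle heq (mem_range.1 hi)
  have h1 := ex_const hx 1
  have h2 := ex_id hx
  rw [ex_eq_sum_idx hn hθ hs, sum_idx hθ] at h1 h2
  rw [sum_congr rfl fun _ hi => by rw [hw _ hi, mul_one], mul_one, mul_one] at h1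
  rw [sum_congr rfl fun i hi => by rw [hw i hi], pt_last, pt_zero, mul_one, mul_neg_one] at h2
  have hpos := extreme_mass_pos hθ h1 h2
  have hsub : (idx n θ).image (post n) ⊆ x.support := by
    intro q hq
    obtain ⟨i, hi, rfl⟩ := mem_image.1 hq
    rw [Finsupp.mem_support_iff]
    rw [mem_idx] at hi
    rcases hi with hi | rfl
    · cases i with
      | zero => exact hpos.1.ne'
      | succ i =>
        rw [hw i (mem_range.2 (by omega))]
        positivity
    · exact hpos.2.ne'
  calc θ + 2 = #((idx n θ).image (post n)) := by
        rw [card_image_of_injOn (post_injOn hn hθ), card_idx hθ]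
    _ ≤ #x.support := card_le_card hsub

/-! ### An optimal menu -/

/-- The weights of an optimal signal for type `θ`. -/
def wt (n θ i : ℕ) : ℝ :=
  if i = 0 then (1 - ∑ k ∈ range θ, 1 / (2 * n) * (1 + pt n (k + 1))) / 2
  else if i = n + 1 then (1 - ∑ k ∈ range θ, 1 / (2 * n) * (1 - pt n (k + 1))) / 2
  else 1 / (2 * n)

/-- An optimal signal for type `θ`. -/
def sig (n θ : ℕ) : (Fin 2 → ℝ) →₀ ℝ := ∑ i ∈ idx n θ, Finsupp.single (post n i) (wt n θ i)

lemma wt_zero (n θ : ℕ) :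
    wt n θ 0 = (1 - ∑ k ∈ range θ, 1 / (2 * n) * (1 + pt n (k + 1))) / 2 := if_pos rfl

lemma wt_last (n θ : ℕ) :
    wt n θ (n + 1) = (1 - ∑ k ∈ range θ, 1 / (2 * n) * (1 - pt n (k + 1))) / 2 := by
  rw [wt, if_neg (Nat.succ_ne_zero n), if_pos rfl]

lemma wt_succ {n θ i : ℕ} (hθ : θ < n) (hi : i < θ) : wt n θ (i + 1) = 1 / (2 * n) := by
  rw [wt, if_neg (Nat.succ_ne_zero i), if_neg (by omega)]

lemma sum_wt {n θ : ℕ} (hθ : θ < n) : ∑ i ∈ idx n θ, wt n θ i = 1 := by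
  rw [sum_idx hθ, sum_congr rfl fun i hi => wt_succ hθ (mem_range.1 hi), wt_zero, wt_last]
  simp only [mul_add, mul_sub, sum_add_distrib, sum_sub_distrib, mul_one]
  ring

lemma sum_wt_mul_pt {n θ : ℕ} (hθ : θ < n) : ∑ i ∈ idx n θ, wt n θ i * pt n i = 0 := by
  rw [sum_idx hθ, sum_congr rfl fun i hi => by rw [wt_succ hθ (mem_range.1 hi)], wt_zero, wt_last,
    pt_zero, pt_last]
  simp only [mul_add, mul_sub, sum_add_distrib, sum_sub_distrib, mul_one]
  ring

lemma wt_nonneg {n θ i : ℕ} (hθ : θ < n) (hi : i ∈ idx n θ) : 0 ≤ wt n θ i := by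
  have h1 := sum_wt hθ
  have h2 := sum_wt_mul_pt hθ
  rw [sum_idx hθ] at h1 h2
  rw [sum_congr rfl fun i hi => wt_succ hθ (mem_range.1 hi)] at h1
  rw [sum_congr rfl fun i hi => by rw [wt_succ hθ (mem_range.1 hi)], pt_last, pt_zero, mul_one,
    mul_neg_one] at h2
  have hpos := extreme_mass_pos hθ h1 h2
  rw [mem_idx] at hi
  rcases hi with hi | rfl
  · cases i with
    | zero => exact hpos.1.le
    | succ i => rw [wt_succ hθ hi]; positivity
  · exact hpos.2.le

lemma sig_post {n θ i : ℕ} (hn : 1 ≤ n) (hθ : θ < n) (hi : i ∈ idx n θ) :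
    sig n θ (post n i) = wt n θ i := by
  rw [sig, Finsupp.finsetSum_apply, sum_eq_single i]
  · rw [Finsupp.single_eq_same]
  · intro j hj hji
    exact Finsupp.single_eq_of_ne fun h => hji (post_injOn hn hθ hj hi h.symm)
  · exact fun h => absurd hi h

lemma support_sig (n θ : ℕ) : (sig n θ).support ⊆ (idx n θ).image (post n) := by
  intro q hq
  rw [Finsupp.mem_support_iff, sig, Finsupp.finsetSum_apply] at hq
  obtain ⟨i, hi, h⟩ := exists_ne_zero_of_sum_ne_zero hq
  refine mem_image.2 ⟨i, hi, ?_⟩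
  by_contra hne
  exact h (Finsupp.single_eq_of_ne (Ne.symm hne))

lemma sum_support_eq_ex {x : (Fin 2 → ℝ) →₀ ℝ} (hx : ∀ q ∈ x.support, IsDist q) (ω : Fin 2) :
    ∑ q ∈ x.support, x q * q ω = ex x fun y => (1 + (if ω = 0 then -1 else 1) * y) / 2 := by
  refine sum_congr rfl fun q hq => ?_
  have h := (hx q hq).2
  rw [Fin.sum_univ_two] at h
  congr 1
  fin_cases ω
  · simp; linarith
  · simp; linarith

lemma feas_sig {n θ : ℕ} (hn : 1 ≤ n) (hθ : θ < n) : Feas (sig n θ) := by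
  have hs := support_sig n θ
  have hd : ∀ q ∈ (sig n θ).support, IsDist q := fun q hq => by
    obtain ⟨i, hi, rfl⟩ := mem_image.1 (hs hq)
    exact isDist_post hn (le_of_mem_idx hθ hi)
  have h1 : ex (sig n θ) (fun _ => 1) = 1 := by
    rw [ex_eq_sum_idx hn hθ hs, sum_congr rfl fun i hi => by rw [sig_post hn hθ hi, mul_one],
      sum_wt hθ]
  have h2 : ex (sig n θ) (fun y => y) = 0 := by
    rw [ex_eq_sum_idx hn hθ hs, ← sum_wt_mul_pt hθ]
    exact sum_congr rfl fun i hi => by rw [sig_post hn hθ hi]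
  refine ⟨hd, fun q => ?_, ?_, fun ω => ?_⟩
  · by_cases hq : q ∈ (sig n θ).support
    · obtain ⟨i, hi, rfl⟩ := mem_image.1 (hs hq)
      rw [sig_post hn hθ hi]
      exact wt_nonneg hθ hi
    · rw [Finsupp.notMem_support_iff.1 hq]
  · rw [← h1]
    simp only [ex, mul_one]
  · rw [sum_support_eq_ex hd]
    have e : (fun y : ℝ => (1 + (if ω = 0 then -1 else 1) * y) / 2) =
        fun y => 1 / 2 * 1 + (if ω = 0 then -1 else 1) / 2 * y := by
      funext y; ring
    rw [e, ex_comb, h1, h2]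
    ring

lemma sum_sig_drop {n j θ : ℕ} (hn : 1 ≤ n) (hθ : θ < n) (hj : j ≤ θ) :
    ∑ i ∈ idx n θ, sig n θ (post n i) * drop n j i = price n j - price n θ := by
  induction hj using Nat.decreasingInduction with
  | self => rw [sum_drop_self, sub_self]
  | of_succ j hj ih =>
    rw [sum_drop hj hθ fun i => sig n θ (post n i), ih, sig_post hn hθ (mem_idx.2 (by omega)),
      wt_succ hθ hj, price_succ]
    ring

lemma ex_sig_eq {n j θ : ℕ} (hn : 1 ≤ n) (hθ : θ < n) (hj : j ≤ θ) :
    ex (sig n θ) (gv n j) = price n θ ∧ ex (sig n θ) (hv n j) = price n θ := by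
  have hx := feas_sig hn hθ
  have hs := support_sig n θ
  induction j with
  | zero =>
    have : ex (sig n θ) (gv n 0) = price n θ := by
      rw [ex_gv_zero_idx hn hθ hx hs, sum_sig_drop hn hθ hj, price_zero]
      ring
    exact ⟨this, this⟩
  | succ m ih =>
    have ih := (ih (by omega)).2
    have : ex (sig n θ) (gv n (m + 1)) = price n θ := by
      rw [ex_gv_succ_idx hn (by omega) hθ hx hs, sum_sig_drop hn hθ hj, ih]
      ring
    refine ⟨this, ?_⟩
    rw [ex_hv_succ, ih, this]
    ring

lemma ex_sig_le {n j θ : ℕ} (hn : 1 ≤ n) (hθ : θ < n) (hj : j < n) :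
    ex (sig n θ) (gv n j) ≤ price n θ := by
  induction j using Nat.strong_induction_on with
  | _ j ih =>
    rcases Nat.lt_or_ge θ j with h | h
    · obtain ⟨m, rfl⟩ : ∃ m, j = m + 1 := ⟨j - 1, by omega⟩
      have h1 := ex_gv_succ_le hn hj (feas_sig hn hθ)
      have h2 : ex (sig n θ) (hv n m) ≤ price n θ :=
        ex_hv_le fun k hk => ih k (by omega) (by omega)
      have h3 := price_anti hn h.le hj
      have := al_pos hn
      have := al_le hn
      nlinarith
    · exact (ex_sig_eq hn hθ h).1.le

/-! ### The context as a Pricing Mappings instance -/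

/-- The payoff function of the context. -/
def payoff (n : ℕ) (θ : Fin n) (ω : Fin 2) (a : Fin (2 * n + 3 + 1)) : ℝ :=
  line n θ a (if ω = 0 then -1 else 1)

/-- The probability of type `θ`. -/
def typeProb (n θ : ℕ) : ℝ := (al n / 2) ^ θ / ∑ i ∈ range n, (al n / 2) ^ i

/-- The joint distribution: the state is uniform and independent of the type. -/
def joint (n : ℕ) (_ : Fin 2) (θ : Fin n) : ℝ := typeProb n θ / 2

lemma sum_pow_pos {n : ℕ} (hn : 1 ≤ n) : 0 < ∑ i ∈ range n, (al n / 2) ^ i := by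
  have := al_pos hn
  exact sum_pos (fun i _ => by positivity) (nonempty_range_iff.2 (by omega))

lemma typeProb_pos {n : ℕ} (hn : 1 ≤ n) (θ : ℕ) : 0 < typeProb n θ := by
  have := al_pos hn
  have := sum_pow_pos hn
  unfold typeProb
  positivity

lemma sum_typeProb {n : ℕ} (hn : 1 ≤ n) : ∑ θ : Fin n, typeProb n θ = 1 := by
  rw [Fin.sum_univ_eq_sum_range (typeProb n)]
  unfold typeProb
  rw [← sum_div, div_self (sum_pow_pos hn).ne']

lemma margT_joint {n : ℕ} (θ : Fin n) : margT (joint n) θ = typeProb n θ := by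
  simp only [margT, joint, Fin.sum_univ_two]
  ring

lemma margO_joint {n : ℕ} (hn : 1 ≤ n) : margO (joint n) = fun _ => 1 / 2 := by
  funext ω
  simp only [margO, joint]
  rw [← sum_div, sum_typeProb hn]

lemma Dq_joint {n : ℕ} (hn : 1 ≤ n) (θ : Fin n) (q : Fin 2 → ℝ) (ω : Fin 2) :
    Dq (joint n) θ q ω = typeProb n θ * q ω := by
  rw [Dq, margO_joint hn, joint]
  ring

lemma vfun_payoff {n : ℕ} (hn : 1 ≤ n) (θ : Fin n) {q : Fin 2 → ℝ} (hq : IsDist q) :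
    vfun (payoff n) θ (Dq (joint n) θ q) = typeProb n θ * gv n θ (q 1 - q 0) := by
  have hm := typeProb_pos hn θ
  have key : ∀ a : Fin (2 * n + 3 + 1), ∑ ω, Dq (joint n) θ q ω * payoff n θ ω a =
      typeProb n θ * line n θ a (q 1 - q 0) := by
    intro a
    have h := hq.2
    rw [Fin.sum_univ_two] at h
    have h0 : (1 - (q 1 - q 0)) / 2 = q 0 := by linarith
    have h1 : (1 + (q 1 - q 0)) / 2 = q 1 := by linarith
    rw [line_affine n θ a (q 1 - q 0), h0, h1, Fin.sum_univ_two, Dq_joint hn, Dq_joint hn]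
    simp only [payoff, if_true, one_ne_zero, if_false]
    ring
  unfold vfun
  simp only [key]
  apply le_antisymm
  · exact sup'_le _ _ fun a _ => mul_le_mul_of_nonneg_left (line_le_gv a.2 _) hm.le
  · obtain ⟨a, ha, h⟩ := exists_gv_eq n θ (q 1 - q 0)
    rw [h]
    exact le_sup' (fun a : Fin (2 * n + 3 + 1) => typeProb n θ * line n θ a (q 1 - q 0))
      (mem_univ (⟨a, ha⟩ : Fin (2 * n + 3 + 1)))

lemma PMutil_payoff {n : ℕ} (hn : 1 ≤ n) (θ : Fin n) {x : (Fin 2 → ℝ) →₀ ℝ} (hx : Feas x) :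
    PMutil (payoff n) (joint n) θ x = typeProb n θ * ex x (gv n θ) := by
  rw [PMutil, ex, mul_sum]
  refine sum_congr rfl fun q hq => ?_
  rw [vfun_payoff hn θ (hx.1 q hq)]
  ring

lemma vfun_prior {n : ℕ} (hn : 1 ≤ n) (θ : Fin n) :
    vfun (payoff n) θ (Dq (joint n) θ (margO (joint n))) = 0 := by
  rw [margO_joint hn, vfun_payoff hn θ ⟨fun _ => by norm_num, by norm_num⟩, sub_self,
    (gv_hv_zero hn θ.2).1, mul_zero]

lemma PMvalid_payoff_iff {n : ℕ} (hn : 1 ≤ n) (x : Fin n → (Fin 2 → ℝ) →₀ ℝ) (t : Fin n → ℝ) :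
    PMvalid (payoff n) (joint n) x t ↔
      (∀ θ, Feas (x θ)) ∧ (∀ θ, 0 ≤ t θ) ∧ (∀ θ : Fin n, 0 ≤ ex (x θ) (gv n θ) - t θ) ∧
      (∀ θ θ' : Fin n, ex (x θ') (gv n θ) - t θ' ≤ ex (x θ) (gv n θ) - t θ) := by
  rw [PMvalid, margO_joint hn]
  refine and_congr_right fun hx => and_congr_right fun _ => and_congr ?_ ?_
  · refine forall_congr' fun θ => ?_
    have h := vfun_prior hn θ
    rw [margO_joint hn] at h
    rw [h, PMutil_payoff hn θ (hx θ), margT_joint, ← mul_sub,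
      mul_nonneg_iff_of_pos_left (typeProb_pos hn θ)]
  · refine forall_congr' fun θ => forall_congr' fun θ' => ?_
    rw [PMutil_payoff hn θ (hx θ), PMutil_payoff hn θ (hx θ'), margT_joint, ← mul_sub,
      ← mul_sub, mul_le_mul_iff_right₀ (typeProb_pos hn θ)]
    refine ⟨fun h => ?_, fun h _ => h⟩
    by_cases e : θ' = θ
    · rw [e]
    · exact h e

lemma PMrev_joint {n : ℕ} (t : ℕ → ℝ) :
    PMrev (joint n) (fun θ => t θ) =
      (∑ θ ∈ range n, (al n / 2) ^ θ * t θ) / ∑ i ∈ range n, (al n / 2) ^ i := by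
  simp only [PMrev, margT_joint]
  rw [Fin.sum_univ_eq_sum_range (fun θ => typeProb n θ * t θ), sum_div]
  exact sum_congr rfl fun θ _ => by rw [typeProb]; ring

lemma exists_nat_of_PMvalid {n : ℕ} (hn : 1 ≤ n) {x : Fin n → (Fin 2 → ℝ) →₀ ℝ} {t : Fin n → ℝ}
    (h : PMvalid (payoff n) (joint n) x t) :
    ∃ (X : ℕ → (Fin 2 → ℝ) →₀ ℝ) (s : ℕ → ℝ),
      x = (fun θ : Fin n => X θ) ∧ t = (fun θ : Fin n => s θ) ∧
      (∀ θ < n, Feas (X θ)) ∧ (∀ θ < n, 0 ≤ ex (X θ) (gv n θ) - s θ) ∧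
      ∀ j < n, ∀ θ < n, ex (X θ) (gv n j) - s θ ≤ ex (X j) (gv n j) - s j := by
  obtain ⟨hX, -, hIR, hIC⟩ := (PMvalid_payoff_iff hn x t).1 h
  have hx : ∀ θ (hθ : θ < n), (if h : θ < n then x ⟨θ, h⟩ else 0) = x ⟨θ, hθ⟩ :=
    fun θ hθ => dif_pos hθ
  have ht : ∀ θ (hθ : θ < n), (if h : θ < n then t ⟨θ, h⟩ else 0) = t ⟨θ, hθ⟩ :=
    fun θ hθ => dif_pos hθ
  refine ⟨fun θ => if h : θ < n then x ⟨θ, h⟩ else 0, fun θ => if h : θ < n then t ⟨θ, h⟩ else 0,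
    funext fun θ => (hx θ θ.2).symm, funext fun θ => (ht θ θ.2).symm,
    fun θ hθ => ?_, fun θ hθ => ?_, fun j hj θ hθ => ?_⟩ <;> dsimp only
  · rw [hx θ hθ]
    exact hX ⟨θ, hθ⟩
  · rw [hx θ hθ, ht θ hθ]
    exact hIR ⟨θ, hθ⟩
  · rw [hx θ hθ, ht θ hθ, hx j hj, ht j hj]
    exact hIC ⟨j, hj⟩ ⟨θ, hθ⟩

lemma PMvalid_sig {n : ℕ} (hn : 1 ≤ n) :
    PMvalid (payoff n) (joint n) (fun θ => sig n θ) (fun θ => price n θ) := by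
  refine (PMvalid_payoff_iff hn _ _).2 ⟨fun θ => feas_sig hn θ.2, fun θ => (price_pos hn θ.2).le,
    fun θ => ?_, fun θ θ' => ?_⟩
  · rw [(ex_sig_eq hn θ.2 le_rfl).1, sub_self]
  · rw [(ex_sig_eq hn θ.2 le_rfl).1, sub_self]
    exact sub_nonpos.2 (ex_sig_le hn θ'.2 θ.2)

lemma PMrev_le {n : ℕ} (hn : 1 ≤ n) {x : Fin n → (Fin 2 → ℝ) →₀ ℝ} {t : Fin n → ℝ}
    (h : PMvalid (payoff n) (joint n) x t) :
    PMrev (joint n) t ≤ PMrev (joint n) fun θ => price n θ := by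
  obtain ⟨X, s, rfl, rfl, hX, hIR, hIC⟩ := exists_nat_of_PMvalid hn h
  have ha := al_pos hn
  rw [PMrev_joint, PMrev_joint, div_le_div_iff_of_pos_right (sum_pow_pos hn), ← sub_nonpos,
    ← sum_sub_distrib]
  simp only [← mul_sub]
  refine (revenue_bound hn hX hIR hIC le_rfl).trans (neg_nonpos.2 (mul_nonneg (by positivity) ?_))
  exact sum_nonneg fun j hj => hIR j (mem_range.1 hj)

lemma Rc_eq {n : ℕ} (hn : 1 ≤ n) :
    Rc (payoff n) (joint n) = PMrev (joint n) fun θ => price n θ := by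
  refine IsGreatest.csSup_eq ⟨⟨_, _, PMvalid_sig hn, rfl⟩, ?_⟩
  rintro _ ⟨x, t, h, rfl⟩
  exact PMrev_le hn h

lemma card_support_of_PMrev_eq_Rc {n : ℕ} (hn : 1 ≤ n) {x : Fin n → (Fin 2 → ℝ) →₀ ℝ}
    {t : Fin n → ℝ} (h : PMvalid (payoff n) (joint n) x t)
    (hopt : PMrev (joint n) t = Rc (payoff n) (joint n)) (θ : Fin n) :
    (θ : ℕ) + 2 ≤ #(x θ).support := by
  obtain ⟨X, s, rfl, rfl, hX, hIR, hIC⟩ := exists_nat_of_PMvalid hn h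
  rw [Rc_eq hn, PMrev_joint, PMrev_joint, div_left_inj' (sum_pow_pos hn).ne'] at hopt
  have key := eq_price_of_optimal hn hX hIR hIC hopt
  have hθ := key θ θ.2
  refine card_support_optimal hn θ.2 (hX θ θ.2) (fun j hj => ?_) hθ.1
  have h1 := hIC j hj θ θ.2
  have h2 := key j hj
  rw [h2.1, h2.2, hθ.2] at h1
  linarith

lemma isJoint_joint {n : ℕ} (hn : 1 ≤ n) : IsJoint (joint n) := by
  refine ⟨fun _ θ => (half_pos (typeProb_pos hn θ)).le, ?_⟩
  have h := margO_joint hn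
  change ∑ ω, margO (joint n) ω = 1
  simp only [h]
  norm_num

lemma sum_range_add_two (n : ℕ) : ∑ i ∈ range n, (i + 2) = n * (n + 3) / 2 := by
  have h : (∑ i ∈ range n, (i + 2)) * 2 = n * (n + 3) := by
    induction n with
    | zero => rfl
    | succ n ih => rw [sum_range_succ, add_mul, ih]; ring
  omega

end QuadraticSupport

/-- For every `n ≥ 1` there is a context with `n` buyer types, a binary
state space and a product prior with full support, for which the optimal Pricing Mappings
revenue is attained, and every revenue-optimal valid Pricing Mappings menu uses a signal
support of size at least `θ + 1` for the `θ`-th type (`θ = 1, …, n`), hence total support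
size at least `n(n+3)/2`. -/
theorem quadratic_support_necessary (n : ℕ) (hn : 1 ≤ n) :
    ∃ (k : ℕ) (u : Fin n → Fin 2 → Fin (k + 1) → ℝ) (μ : Fin 2 → Fin n → ℝ),
      IsJoint μ ∧ (∀ ω θ, μ ω θ = margO μ ω * margT μ θ) ∧
      (∀ ω, 0 < margO μ ω) ∧ (∀ θ, 0 < margT μ θ) ∧
      (∃ x t, PMvalid u μ x t ∧ PMrev μ t = Rc u μ) ∧
      (∀ x t, PMvalid u μ x t → PMrev μ t = Rc u μ →
        (∀ θ : Fin n, (θ : ℕ) + 2 ≤ (x θ).support.card) ∧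
        n * (n + 3) / 2 ≤ ∑ θ, (x θ).support.card) := by
  refine ⟨2 * n + 3, QuadraticSupport.payoff n, QuadraticSupport.joint n,
    QuadraticSupport.isJoint_joint hn, fun ω θ => ?_, fun ω => ?_, fun θ => ?_,
    ⟨_, _, QuadraticSupport.PMvalid_sig hn, (QuadraticSupport.Rc_eq hn).symm⟩,
    fun x t h hopt => ?_⟩
  · rw [QuadraticSupport.margO_joint hn, QuadraticSupport.margT_joint, QuadraticSupport.joint]
    ring
  · rw [QuadraticSupport.margO_joint hn]
    norm_num
  · rw [QuadraticSupport.margT_joint]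
    exact QuadraticSupport.typeProb_pos hn θ
  · have hcard := QuadraticSupport.card_support_of_PMrev_eq_Rc hn h hopt
    refine ⟨hcard, ?_⟩
    rw [← QuadraticSupport.sum_range_add_two, ← Fin.sum_univ_eq_sum_range (fun i => i + 2)]
    exact sum_le_sum fun θ _ => hcard θ
end
end
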